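/- Limited-range Rubio de Francia extrapolation: Let 1 ≤ p₋ < p₊ ≤ ∞ and let T be a linear operator simultaneously defined and bounded on L^{p₁}(w̃) for some p₁ ∈ [p₋,p₊] and all weights w̃ ∈ A_{p₁/p₋}(ℝ^d) ∩ RH_{(p₊/p₁)'}(ℝ^d). Then T is also defined and bounded on L^p(w) for all p ∈ (p₋,p₊) and all weights w ∈ A_{p/p₋}(ℝ^d) ∩ RH_{(p₊/p)'}(ℝ^d). -/

import Mathlib

open MeasureTheory Filter ENNReal
open scoped ENNReal NNReal Topology

noncomputable section

namespace PaperMorrey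

/-! ### Cubes, weights, Muckenhoupt classes -/

/-- The axis-parallel cube with corner `a` and side length `r`. -/
def cube {d : ℕ} (a : Fin d → ℝ) (r : ℝ) : Set (Fin d → ℝ) :=
  Set.univ.pi fun i => Set.Icc (a i) (a i + r)

/-- A weight on `ℝ^d`: a locally integrable, a.e. positive function. -/
def IsWeight (d : ℕ) (w : (Fin d → ℝ) → ℝ) : Prop :=
  LocallyIntegrable w volume ∧ ∀ᵐ x ∂(volume : Measure (Fin d → ℝ)), 0 < w x

/-- Interpret a real-valued weight as an `ℝ≥0∞`-valued function. -/
def ofW {d : ℕ} (w : (Fin d → ℝ) → ℝ) : (Fin d → ℝ) → ℝ≥0∞ :=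
  fun x => ENNReal.ofReal (w x)

/-- Average `⟨g⟩_Q = |Q|⁻¹ ∫_Q g` of an `ℝ≥0∞`-valued function over a cube. -/
def avg {d : ℕ} (g : (Fin d → ℝ) → ℝ≥0∞) (a : Fin d → ℝ) (r : ℝ) : ℝ≥0∞ :=
  (∫⁻ x in cube a r, g x) / volume (cube a r)

open Classical in
/-- The Muckenhoupt `A_p` characteristic `[w]_{A_p}` of a weight, for a finite
exponent `1 ≤ p < ∞` (with the usual `L^∞` form when `p = 1`). -/
def apConst (d : ℕ) (p : ℝ) (w : (Fin d → ℝ) → ℝ) : ℝ≥0∞ :=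
  if p = 1 then
    ⨆ (a : Fin d → ℝ) (r : ℝ) (_ : 0 < r),
      avg (ofW w) a r * essSup (fun x => (ofW w x)⁻¹) (volume.restrict (cube a r))
  else
    ⨆ (a : Fin d → ℝ) (r : ℝ) (_ : 0 < r),
      avg (ofW w) a r * (avg (fun x => ofW w x ^ (-(1 / (p - 1)))) a r) ^ (p - 1)

/-- Membership `w ∈ A_p(ℝ^d)` for finite `p ≥ 1`. -/
def MemAp (d : ℕ) (p : ℝ) (w : (Fin d → ℝ) → ℝ) : Prop :=
  IsWeight d w ∧ apConst d p w ≠ ⊤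

open Classical in
/-- The reverse Hölder `RH_σ` characteristic, for `σ ∈ [1,∞]` (an extended real);
`σ = 1` corresponds to the trivial class of all weights. -/
def rhConst (d : ℕ) (σ : ℝ≥0∞) (w : (Fin d → ℝ) → ℝ) : ℝ≥0∞ :=
  if σ = 1 then 0
  else if σ = ⊤ then
    ⨆ (a : Fin d → ℝ) (r : ℝ) (_ : 0 < r),
      essSup (ofW w) (volume.restrict (cube a r)) / avg (ofW w) a r
  else
    ⨆ (a : Fin d → ℝ) (r : ℝ) (_ : 0 < r),
      (avg (fun x => ofW w x ^ σ.toReal) a r) ^ (1 / σ.toReal) / avg (ofW w) a r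

/-- Membership `w ∈ RH_σ(ℝ^d)` for `σ ∈ [1,∞]`; `RH_1` is the class of all weights. -/
def MemRH (d : ℕ) (σ : ℝ≥0∞) (w : (Fin d → ℝ) → ℝ) : Prop :=
  IsWeight d w ∧ rhConst d σ w ≠ ⊤

open Classical in
/-- The conjugate exponent `q' = q/(q-1) ∈ [1,∞]` of a real exponent `q ≥ 1`,
as an extended real (`1' = ∞`). -/
def eConj (q : ℝ) : ℝ≥0∞ :=
  if q ≤ 1 then ⊤ else ENNReal.ofReal (q / (q - 1))

open Classical in
/-- The conjugate exponent `(p₊/p)'` of the ratio of an extended exponent `p₊ ∈ (1,∞]`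
and a finite exponent `p`; in particular it equals `1` when `p₊ = ∞`. -/
def ratioConj (pp : ℝ≥0∞) (p : ℝ) : ℝ≥0∞ :=
  if pp = ⊤ then 1 else eConj (pp.toReal / p)

/-! ### Weighted Lebesgue and Morrey norms -/

/-- The weighted Lebesgue norm `‖f‖_{L^p(w)} = (∫_{ℝ^d} |f|^p w)^{1/p}` (finite `p`). -/
def wLpNorm (d : ℕ) (p : ℝ) (w : (Fin d → ℝ) → ℝ) (f : (Fin d → ℝ) → ℂ) : ℝ≥0∞ :=
  (∫⁻ x, (‖f x‖₊ : ℝ≥0∞) ^ p * ofW w x) ^ (1 / p)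

/-- The Samko weighted Morrey norm
`‖f‖_{𝓛^{p,λ}(w)} = sup_Q |Q|^{-λ/(dp)} (∫_Q |f|^p w)^{1/p}`. -/
def morreyNorm (d : ℕ) (p lam : ℝ) (w : (Fin d → ℝ) → ℝ) (f : (Fin d → ℝ) → ℂ) : ℝ≥0∞ :=
  ⨆ (a : Fin d → ℝ) (r : ℝ) (_ : 0 < r),
    volume (cube a r) ^ (-(lam / ((d : ℝ) * p))) *
      (∫⁻ x in cube a r, (‖f x‖₊ : ℝ≥0∞) ^ p * ofW w x) ^ (1 / p)

/-! ### Bounded and compact operators w.r.t. extended (semi)norms -/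

/-- `T` is a bounded operator from the space with extended norm `N`
to the space with extended norm `M`. -/
def OpBounded {V W : Type*} (N : V → ℝ≥0∞) (M : W → ℝ≥0∞) (T : V → W) : Prop :=
  ∃ C : ℝ≥0∞, C ≠ ⊤ ∧ ∀ f, M (T f) ≤ C * N f

/-- `T` is a compact operator from the space with extended norm `N` to the
(complete) space with extended norm `M`: the image of the unit ball is
totally bounded, i.e. every sequence in it has a subsequence whose image
is Cauchy in `M`. -/
def OpCompact {V W : Type*} [AddCommGroup W] (N : V → ℝ≥0∞) (M : W → ℝ≥0∞) (T : V → W) : Prop :=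
  ∀ f : ℕ → V, (∀ n, N (f n) ≤ 1) →
    ∃ φ : ℕ → ℕ, StrictMono φ ∧
      ∀ ε : ℝ≥0∞, 0 < ε → ∃ K : ℕ, ∀ m ≥ K, ∀ n ≥ K,
        M (T (f (φ m)) - T (f (φ n))) < ε

/-! ### BMO, CMO and commutators -/

/-- Average of a real function over a cube. -/
def cavg {d : ℕ} (g : (Fin d → ℝ) → ℝ) (a : Fin d → ℝ) (r : ℝ) : ℝ :=
  (volume (cube a r)).toReal⁻¹ * ∫ x in cube a r, g x

/-- The BMO norm `sup_Q ⟨|b - ⟨b⟩_Q|⟩_Q`. -/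
def bmoNorm (d : ℕ) (b : (Fin d → ℝ) → ℝ) : ℝ≥0∞ :=
  ⨆ (a : Fin d → ℝ) (r : ℝ) (_ : 0 < r),
    ENNReal.ofReal (cavg (fun x => |b x - cavg b a r|) a r)

/-- `b ∈ BMO(ℝ^d)`. -/
def MemBMO (d : ℕ) (b : (Fin d → ℝ) → ℝ) : Prop :=
  LocallyIntegrable b volume ∧ bmoNorm d b ≠ ⊤

/-- `b ∈ CMO(ℝ^d)`: `b` lies in the closure of `C_c^∞(ℝ^d)` in the BMO norm. -/
def MemCMO (d : ℕ) (b : (Fin d → ℝ) → ℝ) : Prop :=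
  MemBMO d b ∧ ∀ ε : ℝ≥0∞, 0 < ε → ∃ g : (Fin d → ℝ) → ℝ,
    ContDiff ℝ (⊤ : ℕ∞) g ∧ HasCompactSupport g ∧ bmoNorm d (fun x => b x - g x) < ε

/-- The commutator `[b,T] f = b · T f - T (b · f)`. -/
def commutator {d : ℕ} (b : (Fin d → ℝ) → ℝ)
    (T : ((Fin d → ℝ) → ℂ) → ((Fin d → ℝ) → ℂ)) :
    ((Fin d → ℝ) → ℂ) → ((Fin d → ℝ) → ℂ) :=
  fun f x => (b x : ℂ) * T f x - T (fun y => (b y : ℂ) * f y) x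

/-- The Euclidean norm on `ℝ^d` (the underlying type carries the sup norm). -/
def euclidNorm {d : ℕ} (x : Fin d → ℝ) : ℝ :=
  Real.sqrt (∑ i, x i ^ 2)

end PaperMorrey

namespace PaperMorrey

section

open Metric Set

lemma laverage_const_mul {X : Type*} [MeasurableSpace X] (μ : Measure X) {f : X → ℝ≥0∞}
    (hf : Measurable f) (a : ℝ≥0∞) (s : Set X) :
    ⨍⁻ y in s, a * f y ∂μ = a * ⨍⁻ y in s, f y ∂μ := by
  simp only [setLAverage_eq, lintegral_const_mul a hf, mul_div_assoc]

section Maximal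

variable {X : Type*} [PseudoMetricSpace X] [MeasurableSpace X]

/-- The uncentred maximal function over open balls with respect to `μ`. -/
def maximal (μ : Measure X) (f : X → ℝ≥0∞) (x : X) : ℝ≥0∞ :=
  ⨆ (c : X) (r : ℝ) (_ : x ∈ ball c r), ⨍⁻ y in ball c r, f y ∂μ

lemma laverage_le_maximal (μ : Measure X) (f : X → ℝ≥0∞) {c x : X} {r : ℝ}
    (hx : x ∈ ball c r) : ⨍⁻ y in ball c r, f y ∂μ ≤ maximal μ f x :=
  le_iSup_of_le c (le_iSup_of_le r (le_iSup_of_le hx le_rfl))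

lemma lt_maximal_iff {μ : Measure X} {f : X → ℝ≥0∞} {x : X} {t : ℝ≥0∞} :
    t < maximal μ f x ↔ ∃ c r, x ∈ ball c r ∧ t < ⨍⁻ y in ball c r, f y ∂μ := by
  simp only [maximal, lt_iSup_iff, exists_prop]

lemma isOpen_lt_maximal (μ : Measure X) (f : X → ℝ≥0∞) (t : ℝ≥0∞) :
    IsOpen {x | t < maximal μ f x} := by
  have : {x | t < maximal μ f x} =
      ⋃ (c : X) (r : ℝ) (_ : t < ⨍⁻ y in ball c r, f y ∂μ), ball c r := by
    ext x
    simp only [mem_ofPred_eq, lt_maximal_iff, mem_iUnion, exists_prop]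
    exact exists_congr fun c => exists_congr fun r => and_comm
  rw [this]
  exact isOpen_iUnion fun c => isOpen_iUnion fun r => isOpen_iUnion fun _ => isOpen_ball

lemma measurable_maximal [OpensMeasurableSpace X] (μ : Measure X) (f : X → ℝ≥0∞) :
    Measurable (maximal μ f) :=
  measurable_of_Ioi fun t => (isOpen_lt_maximal μ f t).measurableSet

/-- A measure for which all balls have positive finite mass and which is doubling. -/
structure IsDoubling (μ : Measure X) (D : ℝ≥0∞) : Prop where
  ne_top : D ≠ ⊤
  ball_ne_zero : ∀ (c : X) (r : ℝ), 0 < r → μ (ball c r) ≠ 0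
  ball_ne_top : ∀ (c : X) (r : ℝ), 0 < r → μ (ball c r) ≠ ⊤
  closedBall_le : ∀ (c : X) (r : ℝ), 0 < r → μ (closedBall c (5 * r)) ≤ D * μ (ball c r)

lemma laverage_tsum [OpensMeasurableSpace X] (μ : Measure X) {f : ℕ → X → ℝ≥0∞}
    (hf : ∀ n, Measurable (f n)) (s : Set X) :
    ⨍⁻ y in s, ∑' n, f n y ∂μ = ∑' n, ⨍⁻ y in s, f n y ∂μ := by
  simp only [setLAverage_eq, div_eq_mul_inv, ENNReal.tsum_mul_right]
  rw [lintegral_tsum fun n => (hf n).aemeasurable]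

lemma maximal_tsum_le [OpensMeasurableSpace X] (μ : Measure X) {f : ℕ → X → ℝ≥0∞}
    (hf : ∀ n, Measurable (f n)) (x : X) :
    maximal μ (fun y => ∑' n, f n y) x ≤ ∑' n, maximal μ (f n) x := by
  refine iSup_le fun c => iSup_le fun r => iSup_le fun hx => ?_
  rw [laverage_tsum μ hf]
  exact ENNReal.tsum_le_tsum fun n => laverage_le_maximal μ _ hx

lemma maximal_const_mul_le (μ : Measure X) {f : X → ℝ≥0∞} (hf : Measurable f) (a : ℝ≥0∞)
    (x : X) : maximal μ (fun y => a * f y) x ≤ a * maximal μ f x := by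
  refine iSup_le fun c => iSup_le fun r => iSup_le fun hx => ?_
  rw [laverage_const_mul μ hf]
  gcongr
  exact laverage_le_maximal μ _ hx

lemma maximal_le_add (μ : Measure X) {f g : X → ℝ≥0∞} (a : ℝ≥0∞)
    (hg : Measurable g) (h : ∀ x, f x ≤ g x + a) (x : X) :
    maximal μ f x ≤ maximal μ g x + a := by
  refine iSup_le fun c => iSup_le fun r => iSup_le fun hx => ?_
  calc ⨍⁻ y in ball c r, f y ∂μ ≤ ⨍⁻ y in ball c r, (g y + a) ∂μ :=
        laverage_mono_ae (Eventually.of_forall h)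
    _ = ⨍⁻ y in ball c r, g y ∂μ + a * (μ (ball c r) / μ (ball c r)) := by
        rw [setLAverage_eq, setLAverage_eq, lintegral_add_left hg, ENNReal.add_div,
          setLIntegral_const, mul_div_assoc]
    _ ≤ maximal μ g x + a := by
        gcongr
        · exact laverage_le_maximal μ _ hx
        · exact mul_le_of_le_one_right' ENNReal.div_self_le_one

variable [SecondCountableTopology X] [OpensMeasurableSpace X]

lemma mul_meas_iUnion_ball_le {μ : Measure X} {D : ℝ≥0∞} (hμ : IsDoubling μ D)
    {f : X → ℝ≥0∞} {t : ℝ≥0∞} {R : ℝ} (A : Set (X × ℝ))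
    (hA : ∀ p ∈ A, 0 < p.2 ∧ p.2 ≤ R ∧ t < ⨍⁻ y in ball p.1 p.2, f y ∂μ) :
    t * μ (⋃ p ∈ A, ball p.1 p.2) ≤ D * ∫⁻ y, f y ∂μ := by
  obtain ⟨u, huA, hdisj, hcov⟩ :=
    Vitali.exists_disjoint_subfamily_covering_enlargement_closedBall A Prod.fst Prod.snd R
      (fun p hp => (hA p hp).2.1) 5 (by norm_num)
  have hdisj' : u.PairwiseDisjoint fun p : X × ℝ => ball p.1 p.2 :=
    hdisj.mono fun p => ball_subset_closedBall
  have hcount : u.Countable := by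
    refine hdisj'.countable_of_isOpen (fun p _ => isOpen_ball) fun p hp => ?_
    exact nonempty_ball.2 (hA p (huA hp)).1
  have hsub : (⋃ p ∈ A, ball p.1 p.2) ⊆ ⋃ p ∈ u, closedBall p.1 (5 * p.2) := by
    refine iUnion₂_subset fun p hp => ?_
    obtain ⟨q, hq, hpq⟩ := hcov p hp
    exact (ball_subset_closedBall.trans hpq).trans
      (subset_biUnion_of_mem (u := fun p : X × ℝ => closedBall p.1 (5 * p.2)) hq)
  have hball : ∀ p ∈ u, t * μ (ball p.1 p.2) ≤ ∫⁻ y in ball p.1 p.2, f y ∂μ := by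
    intro p hp
    obtain ⟨h0, -, ht⟩ := hA p (huA hp)
    rw [setLAverage_eq] at ht
    exact (ENNReal.le_div_iff_mul_le (Or.inl (hμ.ball_ne_zero _ _ h0))
      (Or.inl (hμ.ball_ne_top _ _ h0))).1 ht.le
  have := hcount.to_subtype
  calc t * μ (⋃ p ∈ A, ball p.1 p.2)
      ≤ t * ∑' p : u, μ (closedBall p.1.1 (5 * p.1.2)) := by
        gcongr
        exact (measure_mono hsub).trans (measure_biUnion_le μ hcount _)
    _ ≤ t * ∑' p : u, D * μ (ball p.1.1 p.1.2) := by
        gcongr with p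
        exact hμ.closedBall_le _ _ (hA p.1 (huA p.2)).1
    _ = D * ∑' p : u, t * μ (ball p.1.1 p.1.2) := by
        simp only [ENNReal.tsum_mul_left, mul_left_comm]
    _ ≤ D * ∑' p : u, ∫⁻ y in ball p.1.1 p.1.2, f y ∂μ := by
        gcongr with p
        exact hball p.1 p.2
    _ = D * ∫⁻ y in ⋃ p ∈ u, ball p.1 p.2, f y ∂μ := by
        rw [lintegral_biUnion hcount (fun p _ => measurableSet_ball) hdisj']
    _ ≤ D * ∫⁻ y, f y ∂μ := by
        gcongr
        exact Measure.restrict_le_self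

/-- The weak type `(1, 1)` estimate for the maximal function of a doubling measure. -/
lemma mul_meas_lt_maximal_le {μ : Measure X} {D : ℝ≥0∞} (hμ : IsDoubling μ D)
    (f : X → ℝ≥0∞) (t : ℝ≥0∞) :
    t * μ {x | t < maximal μ f x} ≤ D * ∫⁻ y, f y ∂μ := by
  let A : ℕ → Set (X × ℝ) := fun n =>
    {p | 0 < p.2 ∧ p.2 ≤ n ∧ t < ⨍⁻ y in ball p.1 p.2, f y ∂μ}
  have hunion : {x | t < maximal μ f x} = ⋃ n, ⋃ p ∈ A n, ball p.1 p.2 := by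
    ext x
    simp only [mem_ofPred_eq, lt_maximal_iff, mem_iUnion, exists_prop, A]
    constructor
    · rintro ⟨c, r, hx, ht⟩
      obtain ⟨n, hn⟩ := exists_nat_ge r
      exact ⟨n, (c, r), ⟨pos_of_mem_ball hx, hn, ht⟩, hx⟩
    · rintro ⟨n, p, ⟨-, -, ht⟩, hx⟩
      exact ⟨p.1, p.2, hx, ht⟩
  have hmono : Monotone fun n => ⋃ p ∈ A n, ball p.1 p.2 := by
    intro m n hmn
    refine biUnion_subset_biUnion_left fun p hp => ⟨hp.1, hp.2.1.trans ?_, hp.2.2⟩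
    exact_mod_cast hmn
  rw [hunion, hmono.measure_iUnion, ENNReal.mul_iSup]
  exact iSup_le fun n => mul_meas_iUnion_ball_le hμ (A n) fun p hp => hp

end Maximal

section LayerCake
variable {X : Type*} [MeasurableSpace X]

lemma lintegral_rpow_eq_of_ae_ne_top {μ : Measure X} {g : X → ℝ≥0∞} (hg : Measurable g)
    (hfin : ∀ᵐ x ∂μ, g x ≠ ⊤) {s : ℝ} (hs : 0 < s) :
    ∫⁻ x, g x ^ s ∂μ = ENNReal.ofReal s *
      ∫⁻ t in Ioi (0 : ℝ), μ {x | ENNReal.ofReal t < g x} * ENNReal.ofReal (t ^ (s - 1)) := by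
  have key := lintegral_rpow_eq_lintegral_meas_lt_mul μ (f := fun x => (g x).toReal)
    (Eventually.of_forall fun x => ENNReal.toReal_nonneg) hg.ennreal_toReal.aemeasurable hs
  calc ∫⁻ x, g x ^ s ∂μ = ∫⁻ x, ENNReal.ofReal ((g x).toReal ^ s) ∂μ := by
        refine lintegral_congr_ae (hfin.mono fun x hx => ?_)
        dsimp only
        rw [← ENNReal.ofReal_rpow_of_nonneg ENNReal.toReal_nonneg hs.le, ENNReal.ofReal_toReal hx]
    _ = _ := by
        rw [key]
        congr 1
        refine setLIntegral_congr_fun measurableSet_Ioi fun t ht => ?_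
        congr 1
        refine measure_congr (hfin.mono fun x hx => ?_)
        exact propext (ENNReal.ofReal_lt_iff_lt_toReal (le_of_lt ht) hx).symm

lemma lintegral_rpow_le {μ : Measure X} {g : X → ℝ≥0∞} (hg : Measurable g)
    {s : ℝ} (hs : 0 < s) :
    ∫⁻ x, g x ^ s ∂μ ≤ ENNReal.ofReal s *
      ∫⁻ t in Ioi (0 : ℝ), μ {x | ENNReal.ofReal t < g x} * ENNReal.ofReal (t ^ (s - 1)) := by
  have hsup : ∀ x, g x ^ s = ⨆ n : ℕ, (min (g x) n) ^ s := by
    intro x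
    have h1 : g x = ⨆ n : ℕ, min (g x) n := by
      rw [← inf_iSup_eq, ENNReal.iSup_natCast, inf_top_eq]
    conv_lhs => rw [h1]
    exact (ENNReal.orderIsoRpow s hs).map_iSup _
  have hmono : Monotone fun (n : ℕ) x => (min (g x) (n : ℝ≥0∞)) ^ s := by
    intro m n hmn x
    dsimp only
    gcongr
  simp only [hsup]
  rw [lintegral_iSup (fun n => (hg.min measurable_const).pow_const s) hmono]
  refine iSup_le fun n => ?_
  rw [lintegral_rpow_eq_of_ae_ne_top (hg.min measurable_const)
    (Eventually.of_forall fun x => ((min_le_right _ _).trans_lt (ENNReal.natCast_lt_top n)).ne) hs]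
  gcongr with t x
  exact min_le_left _ _

end LayerCake

section StrongType
variable {X : Type*} [PseudoMetricSpace X] [MeasurableSpace X]
  [SecondCountableTopology X] [OpensMeasurableSpace X]

/-- The maximal function of a doubling measure is bounded on `L^s` for `s > 1`. -/
lemma lintegral_maximal_rpow_le {μ : Measure X} {D : ℝ≥0∞} (hμ : IsDoubling μ D)
    {s : ℝ} (hs : 1 < s) :
    ∃ A : ℝ≥0∞, A ≠ ⊤ ∧ ∀ f : X → ℝ≥0∞, Measurable f →
      ∫⁻ x, maximal μ f x ^ s ∂μ ≤ A * ∫⁻ x, f x ^ s ∂μ := by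
  have hs1 : 0 < s - 1 := by linarith
  refine ⟨ENNReal.ofReal s * (2 * D * ((ENNReal.ofReal (s - 1))⁻¹ * 2 ^ (s - 1))) + 1, ?_, ?_⟩
  · have : (ENNReal.ofReal (s - 1))⁻¹ ≠ ⊤ := by simpa using hs1
    finiteness [hμ.ne_top]
  intro f hf
  by_cases htop : ∫⁻ x, f x ^ s ∂μ = ⊤
  · rw [htop, ENNReal.mul_top (by simp)]
    exact le_top
  have hfin : ∀ᵐ x ∂μ, f x ≠ ⊤ := by
    filter_upwards [ae_lt_top (hf.pow_const s) htop] with x hx h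
    rw [h, ENNReal.top_rpow_of_pos (by linarith)] at hx
    exact lt_irrefl _ hx
  set ν := μ.withDensity f
  have hlevel : ∀ t : ℝ, 0 < t →
      μ {x | ENNReal.ofReal t < maximal μ f x} * ENNReal.ofReal (t ^ (s - 1)) ≤
        2 * D * (ν {x | ENNReal.ofReal t < 2 * f x} * ENNReal.ofReal (t ^ (s - 1 - 1))) := by
    intro t ht
    set E : Set X := {x | ENNReal.ofReal t < 2 * f x} with hE
    have hEm : MeasurableSet E := measurableSet_lt measurable_const (hf.const_mul 2)
    set g : X → ℝ≥0∞ := E.indicator f with hg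
    have hgm : Measurable g := hf.indicator hEm
    have hfg : ∀ x, f x ≤ g x + ENNReal.ofReal t / 2 := by
      intro x
      by_cases hx : x ∈ E
      · rw [hg, indicator_of_mem hx]
        exact le_self_add
      · rw [hg, indicator_of_notMem hx, zero_add]
        rw [ENNReal.le_div_iff_mul_le (Or.inl two_ne_zero) (Or.inl ENNReal.ofNat_ne_top), mul_comm]
        exact not_lt.1 hx
    have hsub : {x | ENNReal.ofReal t < maximal μ f x} ⊆
        {x | ENNReal.ofReal t / 2 < maximal μ g x} := by
      intro x hx
      by_contra hcon
      have hle : maximal μ g x ≤ ENNReal.ofReal t / 2 := not_lt.1 hcon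
      have := (maximal_le_add μ _ hgm hfg x).trans (add_le_add_left hle _)
      rw [ENNReal.add_halves] at this
      exact not_lt.2 this hx
    have hweak := mul_meas_lt_maximal_le hμ g (ENNReal.ofReal t / 2)
    have hν : ∫⁻ y, g y ∂μ = ν E := by
      rw [withDensity_apply f hEm, lintegral_indicator hEm]
    rw [hν] at hweak
    have hpow : ENNReal.ofReal (t ^ (s - 1)) =
        2 * (ENNReal.ofReal t / 2) * ENNReal.ofReal (t ^ (s - 1 - 1)) := by
      rw [ENNReal.mul_div_cancel two_ne_zero ENNReal.ofNat_ne_top, ← ENNReal.ofReal_mul ht.le]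
      congr 1
      rw [← Real.rpow_one_add' ht.le (by linarith)]
      ring_nf
    calc μ {x | ENNReal.ofReal t < maximal μ f x} * ENNReal.ofReal (t ^ (s - 1))
        ≤ μ {x | ENNReal.ofReal t / 2 < maximal μ g x} * ENNReal.ofReal (t ^ (s - 1)) := by
          gcongr
      _ = 2 * (ENNReal.ofReal t / 2 * μ {x | ENNReal.ofReal t / 2 < maximal μ g x}) *
            ENNReal.ofReal (t ^ (s - 1 - 1)) := by
          rw [hpow]; ring
      _ ≤ 2 * (D * ν E) * ENNReal.ofReal (t ^ (s - 1 - 1)) := by gcongr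
      _ = _ := by ring
  have hνfin : ∀ᵐ x ∂ν, 2 * f x ≠ ⊤ := by
    refine withDensity_absolutelyContinuous μ f (hfin.mono fun x hx => ?_)
    exact ENNReal.mul_ne_top ENNReal.ofNat_ne_top hx
  have hcake := lintegral_rpow_eq_of_ae_ne_top (hf.const_mul 2) hνfin hs1
  have hne : ENNReal.ofReal (s - 1) ≠ 0 := by simpa using hs1
  calc ∫⁻ x, maximal μ f x ^ s ∂μ
      ≤ ENNReal.ofReal s * ∫⁻ t in Ioi (0 : ℝ),
          μ {x | ENNReal.ofReal t < maximal μ f x} * ENNReal.ofReal (t ^ (s - 1)) :=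
        lintegral_rpow_le (measurable_maximal μ f) (by linarith)
    _ ≤ ENNReal.ofReal s * ∫⁻ t in Ioi (0 : ℝ),
          2 * D * (ν {x | ENNReal.ofReal t < 2 * f x} * ENNReal.ofReal (t ^ (s - 1 - 1))) := by
        gcongr ENNReal.ofReal s * ?_
        exact setLIntegral_mono' measurableSet_Ioi hlevel
    _ = ENNReal.ofReal s * (2 * D * ((ENNReal.ofReal (s - 1))⁻¹ * (ENNReal.ofReal (s - 1) *
          ∫⁻ t in Ioi (0 : ℝ),
          (ν {x | ENNReal.ofReal t < 2 * f x} * ENNReal.ofReal (t ^ (s - 1 - 1)))))) := by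
        rw [lintegral_const_mul' _ _ (by finiteness [hμ.ne_top]),
          ENNReal.inv_mul_cancel_left hne ENNReal.ofReal_ne_top]
    _ = ENNReal.ofReal s * (2 * D * ((ENNReal.ofReal (s - 1))⁻¹ *
          ∫⁻ x, (2 * f x) ^ (s - 1) ∂ν)) := by rw [hcake]
    _ = ENNReal.ofReal s * (2 * D * ((ENNReal.ofReal (s - 1))⁻¹ *
          (2 ^ (s - 1) * ∫⁻ x, f x ^ s ∂μ))) := by
        congr 3
        rw [lintegral_withDensity_eq_lintegral_mul μ hf ((hf.const_mul 2).pow_const _),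
          ← lintegral_const_mul _ (hf.pow_const s)]
        refine lintegral_congr fun x => ?_
        rw [Pi.mul_apply, ENNReal.mul_rpow_of_nonneg _ _ hs1.le, mul_left_comm]
        congr 1
        nth_rewrite 1 [← ENNReal.rpow_one (f x)]
        rw [← ENNReal.rpow_add_of_nonneg _ _ zero_le_one hs1.le]
        ring_nf
    _ ≤ (ENNReal.ofReal s * (2 * D * ((ENNReal.ofReal (s - 1))⁻¹ * 2 ^ (s - 1))) + 1) *
          ∫⁻ x, f x ^ s ∂μ := by
        rw [add_mul]
        refine le_trans (le_of_eq ?_) le_self_add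
        ring

end StrongType

section Averages
variable {X : Type*} [MeasurableSpace X]

lemma laverage_mul_rpow_le (μ : Measure X) {f g : X → ℝ≥0∞} (hf : Measurable f)
    (hg : Measurable g) {p q : ℝ} (hp : 0 ≤ p) (hq : 0 ≤ q) (hpq : p + q = 1) :
    ⨍⁻ x, f x ^ p * g x ^ q ∂μ ≤ (⨍⁻ x, f x ∂μ) ^ p * (⨍⁻ x, g x ∂μ) ^ q :=
  ENNReal.lintegral_mul_norm_pow_le hf.aemeasurable hg.aemeasurable hp hq hpq

lemma one_le_laverage_mul {μ : Measure X} {s : Set X} (h0 : μ s ≠ 0) (h1 : μ s ≠ ⊤)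
    {f : X → ℝ≥0∞} (hf : Measurable f) (hf0 : ∀ x, f x ≠ 0) (hft : ∀ x, f x ≠ ⊤)
    {t : ℝ} (ht : 0 < t) :
    1 ≤ (⨍⁻ x in s, f x ∂μ) * (⨍⁻ x in s, f x ^ (-(1 / t)) ∂μ) ^ t := by
  have hp : 0 ≤ 1 / (1 + t) := by positivity
  have hq : 0 ≤ t / (1 + t) := by positivity
  have hpq : 1 / (1 + t) + t / (1 + t) = 1 := by field_simp
  have key := laverage_mul_rpow_le (μ.restrict s) hf (hf.pow_const (-(1 / t))) hp hq hpq
  have hone : ∀ x, f x ^ (1 / (1 + t)) * (f x ^ (-(1 / t))) ^ (t / (1 + t)) = 1 := by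
    intro x
    rw [← ENNReal.rpow_mul, ← ENNReal.rpow_add _ _ (hf0 x) (hft x)]
    convert! ENNReal.rpow_zero
    field_simp
    ring
  simp only [hone, setLAverage_one h0 h1] at key
  have := ENNReal.rpow_le_rpow key (show 0 ≤ 1 + t by positivity)
  rwa [ENNReal.one_rpow, ENNReal.mul_rpow_of_nonneg _ _ (by positivity), ← ENNReal.rpow_mul,
    ← ENNReal.rpow_mul, one_div_mul_cancel (by positivity), ENNReal.rpow_one,
    div_mul_cancel₀ _ (by positivity)] at this

lemma setLIntegral_ne_zero {μ : Measure X} {s : Set X} (h0 : μ s ≠ 0)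
    {f : X → ℝ≥0∞} (hf : Measurable f) (hf0 : ∀ x, f x ≠ 0) : ∫⁻ x in s, f x ∂μ ≠ 0 := by
  intro h
  rw [lintegral_eq_zero_iff hf] at h
  have : μ.restrict s univ = 0 :=
    measure_mono_null (fun x _ => hf0 x) (show μ.restrict s {x | ¬ f x = 0} = 0 from h)
  simp [h0] at this

lemma setLAverage_ne_zero {μ : Measure X} {s : Set X} (h0 : μ s ≠ 0) (h1 : μ s ≠ ⊤)
    {f : X → ℝ≥0∞} (hf : Measurable f) (hf0 : ∀ x, f x ≠ 0) : ⨍⁻ x in s, f x ∂μ ≠ 0 := by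
  rw [setLAverage_eq]
  exact ENNReal.div_ne_zero.2 ⟨setLIntegral_ne_zero h0 hf hf0, h1⟩

lemma setLIntegral_ne_top_of_setLAverage {μ : Measure X} {s : Set X} (h1 : μ s ≠ ⊤)
    {f : X → ℝ≥0∞} (h : ⨍⁻ x in s, f x ∂μ ≠ ⊤) : ∫⁻ x in s, f x ∂μ ≠ ⊤ := by
  rw [← measure_mul_setLAverage f h1]
  exact ENNReal.mul_ne_top h1 h

lemma setLAverage_mul_withDensity {μ : Measure X} {s : Set X} (hs : MeasurableSet s)
    {f g : X → ℝ≥0∞} (hf : Measurable f) (hg : Measurable g)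
    (h0 : ∫⁻ x in s, f x ∂μ ≠ 0) (h1 : ∫⁻ x in s, f x ∂μ ≠ ⊤) :
    (⨍⁻ x in s, f x ∂μ) * ⨍⁻ x in s, g x ∂(μ.withDensity f) = ⨍⁻ x in s, f x * g x ∂μ := by
  rw [setLAverage_eq, setLAverage_eq, setLAverage_eq, withDensity_apply f hs,
    restrict_withDensity hs, lintegral_withDensity_eq_lintegral_mul _ hf hg]
  simp only [div_eq_mul_inv, Pi.mul_apply]
  rw [mul_right_comm, mul_comm (∫⁻ x in s, f x ∂μ), mul_assoc (∫⁻ x in s, f x * g x ∂μ),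
    ENNReal.inv_mul_cancel h0 h1, mul_one]

end Averages

section Muckenhoupt
variable {d : ℕ}

lemma volume_ball_ne_zero (c : Fin d → ℝ) {r : ℝ} (hr : 0 < r) : volume (ball c r) ≠ 0 :=
  (measure_ball_pos volume c hr).ne'

lemma volume_ball_ne_top (c : Fin d → ℝ) (r : ℝ) : volume (ball c r) ≠ ⊤ := measure_ball_lt_top.ne

lemma volume_ball_six_mul (c : Fin d → ℝ) (r : ℝ) :
    volume (ball c (6 * r)) = 6 ^ d * volume (ball c r) := by
  rw [Measure.addHaar_ball_mul_of_pos volume c (by norm_num) r,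
    ← Measure.addHaar_ball_center volume c r]
  congr 1
  rw [ENNReal.ofReal_pow (by norm_num)]
  simp

/-- The `A_{1+t}` condition over balls, for an everywhere positive and finite density `v`. -/
structure IsMuckenhoupt (v : (Fin d → ℝ) → ℝ≥0∞) (t : ℝ) (C : ℝ≥0∞) : Prop where
  measurable : Measurable v
  ne_zero : ∀ x, v x ≠ 0
  ne_top : ∀ x, v x ≠ ⊤
  pos : 0 < t
  const_ne_top : C ≠ ⊤
  le : ∀ (c : Fin d → ℝ) (r : ℝ), 0 < r →
    (⨍⁻ x in ball c r, v x ∂volume) * (⨍⁻ x in ball c r, v x ^ (-(1 / t)) ∂volume) ^ t ≤ C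

namespace IsMuckenhoupt
variable {v : (Fin d → ℝ) → ℝ≥0∞} {t : ℝ} {C : ℝ≥0∞}

lemma dual_ne_zero (h : IsMuckenhoupt v t C) (x : Fin d → ℝ) : v x ^ (-(1 / t)) ≠ 0 := by
  simp [ENNReal.rpow_eq_zero_iff, h.ne_zero, h.ne_top]

lemma dual_ne_top (h : IsMuckenhoupt v t C) (x : Fin d → ℝ) : v x ^ (-(1 / t)) ≠ ⊤ := by
  simp [ENNReal.rpow_eq_top_iff, h.ne_zero, h.ne_top]

lemma dual_rpow (h : IsMuckenhoupt v t C) (x : Fin d → ℝ) :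
    (v x ^ (-(1 / t))) ^ (-(1 / (1 / t))) = v x := by
  rw [← ENNReal.rpow_mul]
  have := h.pos
  convert! ENNReal.rpow_one _
  field_simp

lemma dual (h : IsMuckenhoupt v t C) :
    IsMuckenhoupt (fun x => v x ^ (-(1 / t))) (1 / t) (C ^ (1 / t)) where
  measurable := h.measurable.pow_const _
  ne_zero := h.dual_ne_zero
  ne_top := h.dual_ne_top
  pos := one_div_pos.2 h.pos
  const_ne_top := ENNReal.rpow_ne_top_of_nonneg (one_div_pos.2 h.pos).le h.const_ne_top
  le := by
    intro c r hr
    simp only [h.dual_rpow]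
    have := ENNReal.rpow_le_rpow (h.le c r hr) (one_div_pos.2 h.pos).le
    rwa [ENNReal.mul_rpow_of_nonneg _ _ (one_div_pos.2 h.pos).le, ← ENNReal.rpow_mul,
      mul_one_div_cancel h.pos.ne', ENNReal.rpow_one, mul_comm] at this

lemma laverage_ne_top (h : IsMuckenhoupt v t C) (c : Fin d → ℝ) {r : ℝ} (hr : 0 < r) :
    ⨍⁻ x in ball c r, v x ∂volume ≠ ⊤ := by
  intro htop
  have hle := h.le c r hr
  have h0 : (⨍⁻ x in ball c r, v x ^ (-(1 / t)) ∂volume) ^ t ≠ 0 := by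
    have := setLAverage_ne_zero (volume_ball_ne_zero c hr) (volume_ball_ne_top c r)
      (h.measurable.pow_const (-(1 / t))) h.dual_ne_zero
    exact (ENNReal.rpow_pos_of_nonneg (pos_iff_ne_zero.2 this) h.pos.le).ne'
  rw [htop, ENNReal.top_mul h0] at hle
  exact h.const_ne_top (top_le_iff.1 hle)

lemma setLIntegral_ne_top (h : IsMuckenhoupt v t C) (c : Fin d → ℝ) {r : ℝ} (hr : 0 < r) :
    ∫⁻ x in ball c r, v x ≠ ⊤ :=
  setLIntegral_ne_top_of_setLAverage (volume_ball_ne_top c r) (h.laverage_ne_top c hr)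

lemma setLIntegral_ne_zero (h : IsMuckenhoupt v t C) (c : Fin d → ℝ) {r : ℝ} (hr : 0 < r) :
    ∫⁻ x in ball c r, v x ≠ 0 :=
  PaperMorrey.setLIntegral_ne_zero (volume_ball_ne_zero c hr) h.measurable h.ne_zero

lemma laverage_ball_le (f : (Fin d → ℝ) → ℝ≥0∞) (c : Fin d → ℝ) (r : ℝ) (hr : 0 < r) :
    ⨍⁻ x in ball c r, f x ∂volume ≤ 6 ^ d * ⨍⁻ x in ball c (6 * r), f x ∂volume := by
  have h6 : (6 : ℝ≥0∞) ^ d ≠ 0 := by positivity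
  have h6t : (6 : ℝ≥0∞) ^ d ≠ ⊤ := by finiteness
  rw [setLAverage_eq, setLAverage_eq, volume_ball_six_mul, ← mul_div_assoc,
    ENNReal.mul_div_mul_left _ _ h6 h6t]
  gcongr
  linarith

lemma isDoubling (h : IsMuckenhoupt v t C) :
    IsDoubling (volume.withDensity v) (6 ^ d * (C * (6 ^ d) ^ t)) where
  ne_top := by
    have := h.const_ne_top
    have : ((6 : ℝ≥0∞) ^ d) ^ t ≠ ⊤ :=
      ENNReal.rpow_ne_top_of_nonneg h.pos.le (by finiteness)
    finiteness
  ball_ne_zero := by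
    intro c r hr
    rw [withDensity_apply v measurableSet_ball]
    exact h.setLIntegral_ne_zero c hr
  ball_ne_top := by
    intro c r hr
    rw [withDensity_apply v measurableSet_ball]
    exact h.setLIntegral_ne_top c hr
  closedBall_le := by
    intro c r hr
    have hsub : closedBall c (5 * r) ⊆ ball c (6 * r) := closedBall_subset_ball (by linarith)
    refine (measure_mono hsub).trans ?_
    rw [withDensity_apply v measurableSet_ball, withDensity_apply v measurableSet_ball,
      ← measure_mul_setLAverage v (volume_ball_ne_top c (6 * r)),
      ← measure_mul_setLAverage v (volume_ball_ne_top c r), volume_ball_six_mul]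
    set B := ball c r
    set B' := ball c (6 * r)
    have hav : ⨍⁻ x in B', v x ∂volume ≤ C * (6 ^ d) ^ t * ⨍⁻ x in B, v x ∂volume := by
      calc ⨍⁻ x in B', v x ∂volume
          ≤ (⨍⁻ x in B', v x ∂volume) *
            ((⨍⁻ x in B, v x ∂volume) * (⨍⁻ x in B, v x ^ (-(1 / t)) ∂volume) ^ t) :=
            le_mul_of_one_le_right' (one_le_laverage_mul (volume_ball_ne_zero c hr)
              (volume_ball_ne_top c r) h.measurable h.ne_zero h.ne_top h.pos)
        _ ≤ (⨍⁻ x in B', v x ∂volume) * ((⨍⁻ x in B, v x ∂volume) *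
              (6 ^ d * ⨍⁻ x in B', v x ^ (-(1 / t)) ∂volume) ^ t) := by
            have := h.pos.le
            gcongr
            exact laverage_ball_le _ c r hr
        _ = ((⨍⁻ x in B', v x ∂volume) * (⨍⁻ x in B', v x ^ (-(1 / t)) ∂volume) ^ t) *
              ((6 ^ d) ^ t * ⨍⁻ x in B, v x ∂volume) := by
            rw [ENNReal.mul_rpow_of_nonneg _ _ h.pos.le]; ring
        _ ≤ C * ((6 ^ d) ^ t * ⨍⁻ x in B, v x ∂volume) := by
            gcongr
            exact h.le c (6 * r) (by linarith)
        _ = _ := by ring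
    calc 6 ^ d * volume B * ⨍⁻ x in B', v x ∂volume
        ≤ 6 ^ d * volume B * (C * (6 ^ d) ^ t * ⨍⁻ x in B, v x ∂volume) := by gcongr
      _ = _ := by ring

/-- Pointwise control of the Lebesgue maximal function by an iteration of two weighted ones. -/
lemma maximal_rpow_le (h : IsMuckenhoupt v t C) {f : (Fin d → ℝ) → ℝ≥0∞} (hf : Measurable f)
    (x : Fin d → ℝ) :
    maximal volume f x ^ t ≤ C * maximal (volume.withDensity v) (fun y =>
      maximal (volume.withDensity fun y => v y ^ (-(1 / t)))
        (fun z => f z / v z ^ (-(1 / t))) y ^ t / v y) x := by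
  set σ : (Fin d → ℝ) → ℝ≥0∞ := fun y => v y ^ (-(1 / t)) with hσ
  have hd : IsMuckenhoupt σ (1 / t) (C ^ (1 / t)) := h.dual
  set m := maximal (volume.withDensity σ) (fun z => f z / σ z) with hm
  have hmm : Measurable m := measurable_maximal _ _
  rw [← ENNReal.le_rpow_inv_iff h.pos]
  refine iSup_le fun c => iSup_le fun r => iSup_le fun hx => ?_
  rw [ENNReal.le_rpow_inv_iff h.pos]
  have hr : 0 < r := pos_of_mem_ball hx
  set a := ⨍⁻ y in ball c r, f y / σ y ∂(volume.withDensity σ) with ha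
  have hfa : ⨍⁻ y in ball c r, f y ∂volume = (⨍⁻ y in ball c r, σ y ∂volume) * a := by
    have hfσ : Measurable fun y => f y / σ y := hf.div hd.measurable
    rw [ha, setLAverage_mul_withDensity measurableSet_ball hd.measurable hfσ
      (hd.setLIntegral_ne_zero c hr) (hd.setLIntegral_ne_top c hr)]
    congr 1
    funext y
    rw [ENNReal.mul_div_cancel (h.dual_ne_zero y) (h.dual_ne_top y)]
  have hat : a ^ t ≤ (⨍⁻ y in ball c r, v y ∂volume) *
      ⨍⁻ y in ball c r, m y ^ t / v y ∂(volume.withDensity v) := by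
    have hmv : Measurable fun y => m y ^ t / v y := (hmm.pow_const t).div h.measurable
    rw [setLAverage_mul_withDensity measurableSet_ball h.measurable hmv
      (h.setLIntegral_ne_zero c hr)
      (h.setLIntegral_ne_top c hr)]
    calc a ^ t = ⨍⁻ y in ball c r, a ^ t ∂volume :=
          (setLAverage_const (volume_ball_ne_zero c hr) (volume_ball_ne_top c r) _).symm
      _ ≤ _ := by
          refine laverage_mono_ae (ae_restrict_of_forall_mem measurableSet_ball fun y hy => ?_)
          dsimp only
          rw [ENNReal.mul_div_cancel (h.ne_zero y) (h.ne_top y)]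
          have := h.pos.le
          gcongr
          exact laverage_le_maximal _ _ hy
  calc (⨍⁻ y in ball c r, f y ∂volume) ^ t
      = (⨍⁻ y in ball c r, σ y ∂volume) ^ t * a ^ t := by
        rw [hfa, ENNReal.mul_rpow_of_nonneg _ _ h.pos.le]
    _ ≤ (⨍⁻ y in ball c r, σ y ∂volume) ^ t * ((⨍⁻ y in ball c r, v y ∂volume) *
          ⨍⁻ y in ball c r, m y ^ t / v y ∂(volume.withDensity v)) := by gcongr
    _ = ((⨍⁻ y in ball c r, v y ∂volume) * (⨍⁻ y in ball c r, σ y ∂volume) ^ t) *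
          ⨍⁻ y in ball c r, m y ^ t / v y ∂(volume.withDensity v) := by ring
    _ ≤ _ := by
        gcongr
        · exact h.le c r hr
        · exact laverage_le_maximal _ _ hx

/-- **Muckenhoupt's theorem**: the maximal function is bounded on `L^{1+t}(v)`, `v ∈ A_{1+t}`. -/
lemma lintegral_maximal_rpow_mul_le (h : IsMuckenhoupt v t C) :
    ∃ A : ℝ≥0∞, A ≠ ⊤ ∧ ∀ f : (Fin d → ℝ) → ℝ≥0∞, Measurable f →
      ∫⁻ x, maximal volume f x ^ (1 + t) * v x ≤ A * ∫⁻ x, f x ^ (1 + t) * v x := by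
  have ht := h.pos
  set σ : (Fin d → ℝ) → ℝ≥0∞ := fun y => v y ^ (-(1 / t)) with hσ
  have hd : IsMuckenhoupt σ (1 / t) (C ^ (1 / t)) := h.dual
  obtain ⟨A₁, hA₁, h₁⟩ := lintegral_maximal_rpow_le h.isDoubling
    (show 1 < (1 + t) / t by rw [lt_div_iff₀ ht]; linarith)
  obtain ⟨A₂, hA₂, h₂⟩ := lintegral_maximal_rpow_le hd.isDoubling
    (show 1 < 1 + t by linarith)
  have he : 0 ≤ (1 + t) / t := by positivity
  refine ⟨C ^ ((1 + t) / t) * (A₁ * A₂), ?_, fun f hf => ?_⟩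
  · have := ENNReal.rpow_ne_top_of_nonneg he h.const_ne_top
    finiteness
  set m := maximal (volume.withDensity σ) (fun z => f z / σ z) with hm
  have hmm : Measurable m := measurable_maximal _ _
  have hfσ : Measurable fun z => f z / σ z := hf.div hd.measurable
  set n := maximal (volume.withDensity v) (fun y => m y ^ t / v y) with hn
  have hnm : Measurable n := measurable_maximal _ _
  have hpt : ∀ x, maximal volume f x ^ (1 + t) ≤ C ^ ((1 + t) / t) * n x ^ ((1 + t) / t) := by
    intro x
    have := ENNReal.rpow_le_rpow (h.maximal_rpow_le hf x) he
    rwa [← ENNReal.rpow_mul, mul_div_cancel₀ _ ht.ne', ENNReal.mul_rpow_of_nonneg _ _ he] at this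
  have e₁ : ∀ x, v x * (m x ^ t / v x) ^ ((1 + t) / t) = σ x * m x ^ (1 + t) := by
    intro x
    rw [ENNReal.div_rpow_of_nonneg _ _ he, ← ENNReal.rpow_mul, mul_div_cancel₀ _ ht.ne',
      div_eq_mul_inv, mul_comm (m x ^ (1 + t)), ← mul_assoc, ← ENNReal.rpow_neg]
    congr 1
    nth_rewrite 1 [← ENNReal.rpow_one (v x)]
    rw [← ENNReal.rpow_add _ _ (h.ne_zero x) (h.ne_top x), hσ]
    congr 1
    field_simp
    ring
  have e₂ : ∀ x, σ x * (f x / σ x) ^ (1 + t) = f x ^ (1 + t) * v x := by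
    intro x
    rw [ENNReal.div_rpow_of_nonneg _ _ (by positivity), div_eq_mul_inv, mul_left_comm,
      ← ENNReal.rpow_neg]
    congr 1
    nth_rewrite 1 [← ENNReal.rpow_one (σ x)]
    rw [← ENNReal.rpow_add _ _ (h.dual_ne_zero x) (h.dual_ne_top x), ← ENNReal.rpow_mul]
    convert! ENNReal.rpow_one _
    field_simp
    ring
  calc ∫⁻ x, maximal volume f x ^ (1 + t) * v x
      ≤ ∫⁻ x, C ^ ((1 + t) / t) * (v x * n x ^ ((1 + t) / t)) := by
        refine lintegral_mono fun x => ?_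
        dsimp only
        rw [mul_comm (v x) (n x ^ _), ← mul_assoc]
        gcongr
        exact hpt x
    _ = C ^ ((1 + t) / t) * ∫⁻ x, n x ^ ((1 + t) / t) ∂(volume.withDensity v) := by
        have hvn : Measurable fun x => v x * n x ^ ((1 + t) / t) :=
          h.measurable.mul (hnm.pow_const _)
        rw [lintegral_const_mul _ hvn,
          lintegral_withDensity_eq_lintegral_mul _ h.measurable (hnm.pow_const _)]
        rfl
    _ ≤ C ^ ((1 + t) / t) *
          (A₁ * ∫⁻ x, (m x ^ t / v x) ^ ((1 + t) / t) ∂(volume.withDensity v)) := by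
        gcongr
        exact h₁ _ ((hmm.pow_const t).div h.measurable)
    _ = C ^ ((1 + t) / t) * (A₁ * ∫⁻ x, m x ^ (1 + t) ∂(volume.withDensity σ)) := by
        have hmv : Measurable fun x => (m x ^ t / v x) ^ ((1 + t) / t) :=
          ((hmm.pow_const t).div h.measurable).pow_const _
        rw [lintegral_withDensity_eq_lintegral_mul _ h.measurable hmv,
          lintegral_withDensity_eq_lintegral_mul _ hd.measurable (hmm.pow_const _)]
        simp only [Pi.mul_apply, e₁]
    _ ≤ C ^ ((1 + t) / t) *
          (A₁ * (A₂ * ∫⁻ x, (f x / σ x) ^ (1 + t) ∂(volume.withDensity σ))) := by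
        gcongr
        exact h₂ _ hfσ
    _ = C ^ ((1 + t) / t) * (A₁ * A₂) * ∫⁻ x, f x ^ (1 + t) * v x := by
        rw [lintegral_withDensity_eq_lintegral_mul _ hd.measurable (hfσ.pow_const _)]
        simp only [Pi.mul_apply, e₂]
        ring

end IsMuckenhoupt
end Muckenhoupt

section

lemma tsum_rpow_le {s : ℝ} (hs : 1 ≤ s) (a : ℕ → ℝ≥0∞) :
    (∑' n, a n) ^ s ≤ 2 ^ s * ∑' n, (2 ^ n * a n) ^ s := by
  have hs0 : 0 < s := by linarith
  set S := ∑' n, (2 ^ n * a n) ^ s with hS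
  have h1 : ∀ n, a n ≤ 2⁻¹ ^ n * S ^ s⁻¹ := by
    intro n
    have h2 : 2 ^ n * a n ≤ S ^ s⁻¹ := by
      rw [ENNReal.le_rpow_inv_iff hs0]
      exact ENNReal.le_tsum n
    calc a n = 2⁻¹ ^ n * (2 ^ n * a n) := by
          rw [← mul_assoc, ← mul_pow, ENNReal.inv_mul_cancel (by simp) (by simp), one_pow, one_mul]
      _ ≤ _ := by gcongr
  calc (∑' n, a n) ^ s ≤ (∑' n, 2⁻¹ ^ n * S ^ s⁻¹) ^ s := by
        gcongr
        exact h1 _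
    _ = 2 ^ s * S := by
        rw [ENNReal.tsum_mul_right, ENNReal.tsum_geometric, ENNReal.one_sub_inv_two, inv_inv,
          ENNReal.mul_rpow_of_nonneg _ _ hs0.le, ← ENNReal.rpow_mul, inv_mul_cancel₀ hs0.ne',
          ENNReal.rpow_one]

section Majorant
variable {X : Type*} [PseudoMetricSpace X] [MeasurableSpace X]

/-- The Rubio de Francia iteration `∑ ρⁿ Mⁿ k`. -/
def rubioSum (μ : Measure X) (ρ : ℝ≥0∞) (k : X → ℝ≥0∞) (x : X) : ℝ≥0∞ :=
  ∑' n : ℕ, ρ ^ n * (maximal μ)^[n] k x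

lemma le_rubioSum (μ : Measure X) (ρ : ℝ≥0∞) (k : X → ℝ≥0∞) (x : X) :
    k x ≤ rubioSum μ ρ k x := by
  have := ENNReal.le_tsum (f := fun n : ℕ => ρ ^ n * (maximal μ)^[n] k x) 0
  simpa [rubioSum] using this

variable [OpensMeasurableSpace X]

lemma measurable_iterate_maximal (μ : Measure X) {k : X → ℝ≥0∞} (hk : Measurable k) (n : ℕ) :
    Measurable ((maximal μ)^[n] k) := by
  cases n with
  | zero => exact hk
  | succ n =>
    rw [Function.iterate_succ_apply']
    exact measurable_maximal _ _

lemma measurable_rubioSum (μ : Measure X) (ρ : ℝ≥0∞) {k : X → ℝ≥0∞} (hk : Measurable k) :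
    Measurable (rubioSum μ ρ k) :=
  Measurable.tsum fun n => (measurable_iterate_maximal μ hk n).const_mul _

lemma mul_maximal_rubioSum_le (μ : Measure X) (ρ : ℝ≥0∞) {k : X → ℝ≥0∞} (hk : Measurable k)
    (x : X) : ρ * maximal μ (rubioSum μ ρ k) x ≤ rubioSum μ ρ k x := by
  have hK := measurable_iterate_maximal μ hk
  calc ρ * maximal μ (rubioSum μ ρ k) x
      ≤ ρ * ∑' n, maximal μ (fun y => ρ ^ n * (maximal μ)^[n] k y) x := by
        gcongr
        exact maximal_tsum_le μ (fun n => (hK n).const_mul _) x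
    _ ≤ ρ * ∑' n, ρ ^ n * (maximal μ)^[n + 1] k x := by
        gcongr with n
        rw [Function.iterate_succ_apply']
        exact maximal_const_mul_le μ (hK n) _ x
    _ = ∑' n, ρ ^ (n + 1) * (maximal μ)^[n + 1] k x := by
        rw [← ENNReal.tsum_mul_left]
        congr 1
        funext n
        rw [pow_succ']
        ring
    _ ≤ rubioSum μ ρ k x :=
        ENNReal.tsum_comp_le_tsum_of_injective (f := fun n : ℕ => n + 1)
          (fun a b hab => by simpa using hab) _

end Majorant

/-- The `A₁` condition over balls, for an everywhere positive and finite density `u`. -/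
structure IsAOne {d : ℕ} (u : (Fin d → ℝ) → ℝ≥0∞) (D : ℝ≥0∞) : Prop where
  const_ne_top : D ≠ ⊤
  measurable : Measurable u
  ne_zero : ∀ x, u x ≠ 0
  ne_top : ∀ x, u x ≠ ⊤
  le : ∀ (c : Fin d → ℝ) (r : ℝ), 0 < r →
    ∀ᵐ x ∂volume.restrict (ball c r), ⨍⁻ y in ball c r, u y ∂volume ≤ D * u x

namespace IsMuckenhoupt
variable {d : ℕ} {v : (Fin d → ℝ) → ℝ≥0∞} {t : ℝ} {C : ℝ≥0∞}

lemma exists_rubioSum (h : IsMuckenhoupt v t C) : ∃ ρ : ℝ≥0∞, ρ ≠ 0 ∧ ρ ≠ ⊤ ∧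
    ∀ k : (Fin d → ℝ) → ℝ≥0∞, Measurable k → ∫⁻ x, k x ^ (1 + t) * v x ≠ ⊤ →
      ∫⁻ x, rubioSum volume ρ k x ^ (1 + t) * v x ≠ ⊤ := by
  obtain ⟨A, hA, hM⟩ := h.lintegral_maximal_rpow_mul_le
  have hs : 1 ≤ 1 + t := by linarith [h.pos]
  set B : ℝ≥0∞ := max A 1 with hB
  have hBt : B ≠ ⊤ := by simp [hB, hA]
  have hB0 : B ≠ 0 := by simp [hB]
  have hAB : A ≤ B := le_max_left _ _
  have h1B : 1 ≤ B := le_max_right _ _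
  refine ⟨2⁻¹ * (2⁻¹ * B⁻¹), by simp [hBt], by finiteness, fun k hk hkt => ?_⟩
  have hK := measurable_iterate_maximal volume hk
  have hit : ∀ n, ∫⁻ x, (maximal volume)^[n] k x ^ (1 + t) * v x
      ≤ B ^ n * ∫⁻ x, k x ^ (1 + t) * v x := by
    intro n
    induction n with
    | zero => simp
    | succ n ih =>
      rw [Function.iterate_succ_apply', pow_succ', mul_assoc]
      refine (hM _ (hK n)).trans ?_
      gcongr
  have hρ : ∀ n : ℕ, ((2 : ℝ≥0∞) ^ n * (2⁻¹ * (2⁻¹ * B⁻¹)) ^ n) = (2⁻¹ * B⁻¹) ^ n := by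
    intro n
    rw [← mul_pow, ← mul_assoc, ENNReal.mul_inv_cancel (by simp) (by simp), one_mul]
  have hle1 : 2⁻¹ * B⁻¹ ≤ 1 := by
    refine mul_le_one' (ENNReal.inv_le_one.2 (by norm_num)) (ENNReal.inv_le_one.2 h1B)
  have hterm : ∀ n : ℕ, ∫⁻ x, (2 ^ n * ((2⁻¹ * (2⁻¹ * B⁻¹)) ^ n *
      (maximal volume)^[n] k x)) ^ (1 + t) * v x ≤ 2⁻¹ ^ n * ∫⁻ x, k x ^ (1 + t) * v x := by
    intro n
    have hm : Measurable fun x => (maximal volume)^[n] k x ^ (1 + t) * v x :=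
      ((hK n).pow_const _).mul h.measurable
    calc _ = ∫⁻ x, ((2⁻¹ * B⁻¹) ^ n) ^ (1 + t) * ((maximal volume)^[n] k x ^ (1 + t) * v x) := by
          congr 1
          funext x
          rw [← mul_assoc (2 ^ n), hρ, ENNReal.mul_rpow_of_nonneg _ _ (by linarith), mul_assoc]
      _ = ((2⁻¹ * B⁻¹) ^ n) ^ (1 + t) * ∫⁻ x, (maximal volume)^[n] k x ^ (1 + t) * v x :=
          lintegral_const_mul _ hm
      _ ≤ (2⁻¹ * B⁻¹) ^ n * (B ^ n * ∫⁻ x, k x ^ (1 + t) * v x) := by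
          gcongr
          · exact ENNReal.rpow_le_self_of_le_one (pow_le_one₀ (by simp) hle1) hs
          · exact hit n
      _ = _ := by
          rw [← mul_assoc, ← mul_pow, mul_assoc 2⁻¹, ENNReal.inv_mul_cancel hB0 hBt, mul_one]
  refine ne_top_of_le_ne_top ?_ (calc
    ∫⁻ x, rubioSum volume (2⁻¹ * (2⁻¹ * B⁻¹)) k x ^ (1 + t) * v x
      ≤ ∫⁻ x, 2 ^ (1 + t) * ∑' n : ℕ, (2 ^ n * ((2⁻¹ * (2⁻¹ * B⁻¹)) ^ n *
          (maximal volume)^[n] k x)) ^ (1 + t) * v x := by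
        refine lintegral_mono fun x => ?_
        dsimp only
        rw [ENNReal.tsum_mul_right, ← mul_assoc (2 ^ (1 + t))]
        exact mul_le_mul_left (tsum_rpow_le hs _) _
    _ = 2 ^ (1 + t) * ∑' n : ℕ, ∫⁻ x, (2 ^ n * ((2⁻¹ * (2⁻¹ * B⁻¹)) ^ n *
          (maximal volume)^[n] k x)) ^ (1 + t) * v x := by
        have hm : ∀ n : ℕ, Measurable fun x => (2 ^ n * ((2⁻¹ * (2⁻¹ * B⁻¹)) ^ n *
          (maximal volume)^[n] k x)) ^ (1 + t) * v x := fun n =>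
          ((((hK n).const_mul _).const_mul _).pow_const _).mul h.measurable
        rw [lintegral_const_mul _ (Measurable.tsum hm),
          lintegral_tsum fun n => (hm n).aemeasurable]
    _ ≤ 2 ^ (1 + t) * ∑' n : ℕ, 2⁻¹ ^ n * ∫⁻ x, k x ^ (1 + t) * v x := by
        gcongr with n
        exact hterm n
    _ = 2 ^ (1 + t) * (2 * ∫⁻ x, k x ^ (1 + t) * v x) := by
        rw [ENNReal.tsum_mul_right, ENNReal.tsum_geometric, ENNReal.one_sub_inv_two, inv_inv])
  have : (2 : ℝ≥0∞) ^ (1 + t) ≠ ⊤ := ENNReal.rpow_ne_top_of_nonneg (by linarith) (by simp)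
  finiteness

/-- Given integrable `Ψ`, there is an `A₁` function `u` with `Ψ ≤ u^{1+t} v` integrable. -/
lemma exists_majorant (h : IsMuckenhoupt v t C) {Ψ : (Fin d → ℝ) → ℝ≥0∞} (hΨ : Measurable Ψ)
    (hΨt : ∫⁻ x, Ψ x ≠ ⊤) :
    ∃ (D : ℝ≥0∞) (u : (Fin d → ℝ) → ℝ≥0∞), IsAOne u D ∧
      (∀ᵐ x, Ψ x ≤ u x ^ (1 + t) * v x) ∧ ∫⁻ x, u x ^ (1 + t) * v x ≠ ⊤ := by
  have hs : 0 < 1 + t := by linarith [h.pos]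
  obtain ⟨ρ, hρ0, hρt, hρ⟩ := h.exists_rubioSum
  obtain ⟨η, hη0, hηm, hηt⟩ := exists_pos_lintegral_lt_of_sigmaFinite
    (volume : Measure (Fin d → ℝ)) (ε := 1) (by simp)
  set k : (Fin d → ℝ) → ℝ≥0∞ := fun x => ((Ψ x + η x) / v x) ^ (1 + t)⁻¹ with hk
  have hkm : Measurable k := ((hΨ.add hηm.coe_nnreal_ennreal).div h.measurable).pow_const _
  have hk0 : ∀ x, k x ≠ 0 := by
    intro x
    refine (ENNReal.rpow_pos_of_nonneg (ENNReal.div_pos ?_ (h.ne_top x)) (by positivity)).ne'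
    have := (hη0 x).ne'
    simp [this]
  have hkv : ∀ x, k x ^ (1 + t) * v x = Ψ x + η x := by
    intro x
    rw [hk]
    dsimp only
    rw [← ENNReal.rpow_mul, inv_mul_cancel₀ hs.ne', ENNReal.rpow_one,
      ENNReal.div_mul_cancel (h.ne_zero x) (h.ne_top x)]
  have hint : ∫⁻ x, k x ^ (1 + t) * v x ≠ ⊤ := by
    simp only [hkv]
    rw [lintegral_add_left hΨ]
    exact ENNReal.add_ne_top.2 ⟨hΨt, (hηt.trans ENNReal.one_lt_top).ne⟩
  have hu := hρ k hkm hint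
  set u₀ := rubioSum volume ρ k with hu₀
  have hum : Measurable u₀ := measurable_rubioSum _ _ hkm
  have hut : ∀ᵐ x, u₀ x ≠ ⊤ := by
    filter_upwards [ae_lt_top ((hum.pow_const _).mul h.measurable) hu] with x hx hx'
    simp [hx', ENNReal.top_rpow_of_pos hs, h.ne_zero x] at hx
  have hkle : ∀ x, k x ≤ u₀ x := le_rubioSum _ _ _
  have hae : (fun x => if u₀ x = ⊤ then 1 else u₀ x) =ᵐ[volume] u₀ := by
    filter_upwards [hut] with x hx
    simp [hx]
  refine ⟨ρ⁻¹, fun x => if u₀ x = ⊤ then 1 else u₀ x, ⟨by simp [hρ0],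
    Measurable.ite (measurableSet_eq_fun hum measurable_const) measurable_const hum,
    fun x => ?_, fun x => ?_, fun c r hr => ?_⟩, ?_, ?_⟩
  · split_ifs with hx
    · simp
    · exact (lt_of_lt_of_le (pos_iff_ne_zero.2 (hk0 x)) (hkle x)).ne'
  · split_ifs with hx
    · simp
    · exact hx
  · rw [setLAverage_congr_fun_ae measurableSet_ball (hae.mono fun x hx _ => hx)]
    filter_upwards [ae_restrict_of_ae hae, ae_restrict_mem measurableSet_ball] with x hx hxb
    rw [hx]
    calc ⨍⁻ y in ball c r, u₀ y ∂volume ≤ maximal volume u₀ x := laverage_le_maximal _ _ hxb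
      _ = ρ⁻¹ * (ρ * maximal volume u₀ x) := by
          rw [← mul_assoc, ENNReal.inv_mul_cancel hρ0 hρt, one_mul]
      _ ≤ ρ⁻¹ * u₀ x := by
          gcongr
          exact mul_maximal_rubioSum_le _ _ hkm x
  · filter_upwards [hae] with x hx
    rw [hx]
    calc Ψ x ≤ k x ^ (1 + t) * v x := by rw [hkv]; exact le_self_add
      _ ≤ _ := by gcongr; exact hkle x
  · convert hu using 1
    refine lintegral_congr_ae ?_
    filter_upwards [hae] with x hx
    rw [hx]

end IsMuckenhoupt

end

section

variable {d : ℕ}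

open Classical in
/-- The `L^{1/α}` mean over a ball, with the essential supremum for `α = 0`. -/
def powerMean (f : (Fin d → ℝ) → ℝ≥0∞) (α : ℝ) (c : Fin d → ℝ) (r : ℝ) : ℝ≥0∞ :=
  if α = 0 then essSup f (volume.restrict (ball c r))
  else (⨍⁻ x in ball c r, f x ^ (1 / α) ∂volume) ^ α

/-- The two-sided class: `‖W‖_{L^{1/α}} ‖W⁻¹‖_{L^{1/β}}` is bounded over normalised balls. -/
structure IsBalanced (W : (Fin d → ℝ) → ℝ≥0∞) (α β : ℝ) : Prop where
  measurable : Measurable W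
  ne_zero : ∀ x, W x ≠ 0
  ne_top : ∀ x, W x ≠ ⊤
  exists_le : ∃ C : ℝ≥0∞, C ≠ ⊤ ∧ ∀ (c : Fin d → ℝ) (r : ℝ), 0 < r →
    powerMean W α c r * powerMean (fun x => (W x)⁻¹) β c r ≤ C

lemma IsBalanced.inv {W : (Fin d → ℝ) → ℝ≥0∞} {α β : ℝ} (h : IsBalanced W α β) :
    IsBalanced (fun x => (W x)⁻¹) β α where
  measurable := h.measurable.inv
  ne_zero x := by simp [h.ne_top x]
  ne_top x := by simp [h.ne_zero x]
  exists_le := by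
    obtain ⟨C, hC, h⟩ := h.exists_le
    refine ⟨C, hC, fun c r hr => ?_⟩
    simp only [inv_inv]
    rw [mul_comm]
    exact h c r hr

lemma IsBalanced.isMuckenhoupt {W : (Fin d → ℝ) → ℝ≥0∞} {α β : ℝ} (h : IsBalanced W α β)
    (hα : 0 < α) (hβ : 0 < β) :
    ∃ C, IsMuckenhoupt (fun x => W x ^ (1 / α)) (β / α) C := by
  obtain ⟨C, hC, hle⟩ := h.exists_le
  refine ⟨C ^ (1 / α), h.measurable.pow_const _, fun x => ?_, fun x => ?_, by positivity,
    ENNReal.rpow_ne_top_of_nonneg (by positivity) hC, fun c r hr => ?_⟩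
  · exact (ENNReal.rpow_pos (pos_iff_ne_zero.2 (h.ne_zero x)) (h.ne_top x)).ne'
  · exact ENNReal.rpow_ne_top_of_ne_zero (h.ne_zero x) (h.ne_top x)
  · have := ENNReal.rpow_le_rpow (hle c r hr) (show 0 ≤ 1 / α by positivity)
    rw [powerMean, powerMean, if_neg hα.ne', if_neg hβ.ne',
      ENNReal.mul_rpow_of_nonneg _ _ (by positivity), ← ENNReal.rpow_mul, ← ENNReal.rpow_mul,
      mul_one_div_cancel hα.ne', ENNReal.rpow_one, mul_one_div] at this
    convert! this using 4
    funext x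
    rw [← ENNReal.rpow_mul, ENNReal.inv_rpow, ← ENNReal.rpow_neg]
    congr 1
    field_simp

lemma IsAOne.laverage_ne_top {u : (Fin d → ℝ) → ℝ≥0∞} {D : ℝ≥0∞} (hu : IsAOne u D)
    (c : Fin d → ℝ) {r : ℝ} (hr : 0 < r) : ⨍⁻ y in ball c r, u y ∂volume ≠ ⊤ := by
  have : (volume.restrict (ball c r)) ≠ 0 := by
    simpa using volume_ball_ne_zero c hr
  have := ae_neBot.2 this
  obtain ⟨x, hx⟩ := (hu.le c r hr).exists
  exact ne_top_of_le_ne_top (ENNReal.mul_ne_top hu.const_ne_top (hu.ne_top x)) hx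

section
variable {v u : (Fin d → ℝ) → ℝ≥0∞} {t : ℝ} {C D : ℝ≥0∞} {α γ : ℝ}

lemma powerMean_mul_rpow_neg_le (h : IsMuckenhoupt v t C) (hu : IsAOne u D) (hα : 0 ≤ α)
    (hγ : 0 < γ) (c : Fin d → ℝ) {r : ℝ} (hr : 0 < r) :
    powerMean (fun x => v x ^ α * u x ^ (-γ)) α c r ≤
      (D / ⨍⁻ y in ball c r, u y ∂volume) ^ γ * (⨍⁻ y in ball c r, v y ∂volume) ^ α := by
  set a := ⨍⁻ y in ball c r, u y ∂volume with ha
  have ha0 : a ≠ 0 :=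
    setLAverage_ne_zero (volume_ball_ne_zero c hr) (volume_ball_ne_top c r) hu.measurable hu.ne_zero
  have hat : a ≠ ⊤ := hu.laverage_ne_top c hr
  have hinv : ∀ᵐ x ∂volume.restrict (ball c r), u x ^ (-γ) ≤ (D / a) ^ γ := by
    filter_upwards [hu.le c r hr] with x hx
    rw [ENNReal.rpow_neg, ← ENNReal.inv_rpow]
    gcongr
    rw [ENNReal.le_div_iff_mul_le (.inl ha0) (.inl hat), mul_comm, ← div_eq_mul_inv]
    exact ENNReal.div_le_of_le_mul hx
  rw [powerMean]
  split_ifs with hα0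
  · subst hα0
    simp only [ENNReal.rpow_zero, one_mul, mul_one]
    exact essSup_le_of_ae_le _ hinv
  · have hα' : 0 < α := lt_of_le_of_ne hα (Ne.symm hα0)
    calc (⨍⁻ x in ball c r, (v x ^ α * u x ^ (-γ)) ^ (1 / α) ∂volume) ^ α
        ≤ (⨍⁻ x in ball c r, ((D / a) ^ γ) ^ (1 / α) * v x ∂volume) ^ α := by
          gcongr ?_ ^ α
          refine laverage_mono_ae ?_
          filter_upwards [hinv] with x hx
          rw [ENNReal.mul_rpow_of_nonneg _ _ (by positivity), ← ENNReal.rpow_mul (v x),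
            mul_one_div_cancel hα0, ENNReal.rpow_one, mul_comm]
          gcongr
      _ = _ := by
          rw [laverage_const_mul _ h.measurable, ENNReal.mul_rpow_of_nonneg _ _ hα,
            ← ENNReal.rpow_mul _ (1 / α), one_div_mul_cancel hα0, ENNReal.rpow_one]

lemma powerMean_inv_mul_rpow_neg_le (h : IsMuckenhoupt v t C) (hu : IsAOne u D) (hα : 0 ≤ α)
    (hγ : 0 < γ) (c : Fin d → ℝ) (r : ℝ) :
    powerMean (fun x => (v x ^ α * u x ^ (-γ))⁻¹) (γ + α * t) c r ≤
      (⨍⁻ y in ball c r, u y ∂volume) ^ γ *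
        (⨍⁻ y in ball c r, v y ^ (-(1 / t)) ∂volume) ^ (α * t) := by
  have ht := h.pos
  have hβ : 0 < γ + α * t := by positivity
  rw [powerMean, if_neg hβ.ne']
  have hpt : ∀ x, ((v x ^ α * u x ^ (-γ))⁻¹) ^ (1 / (γ + α * t)) =
      u x ^ (γ / (γ + α * t)) * (v x ^ (-(1 / t))) ^ (α * t / (γ + α * t)) := by
    intro x
    have h1 : v x ^ α ≠ 0 := (ENNReal.rpow_pos (pos_iff_ne_zero.2 (h.ne_zero x)) (h.ne_top x)).ne'
    have h2 : v x ^ α ≠ ⊤ := ENNReal.rpow_ne_top_of_ne_zero (h.ne_zero x) (h.ne_top x)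
    rw [ENNReal.mul_inv (.inl h1) (.inl h2), ← ENNReal.rpow_neg, ← ENNReal.rpow_neg, neg_neg,
      ENNReal.mul_rpow_of_nonneg _ _ (by positivity), ← ENNReal.rpow_mul, ← ENNReal.rpow_mul,
      ← ENNReal.rpow_mul, mul_comm]
    congr 2
    · ring
    · field_simp
  simp only [hpt]
  calc _ ≤ ((⨍⁻ y in ball c r, u y ∂volume) ^ (γ / (γ + α * t)) *
        (⨍⁻ y in ball c r, v y ^ (-(1 / t)) ∂volume) ^ (α * t / (γ + α * t))) ^ (γ + α * t) := by
        gcongr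
        exact laverage_mul_rpow_le _ hu.measurable (h.measurable.pow_const _) (by positivity)
          (by positivity) (by field_simp)
    _ = _ := by
        rw [ENNReal.mul_rpow_of_nonneg _ _ hβ.le, ← ENNReal.rpow_mul, ← ENNReal.rpow_mul,
          div_mul_cancel₀ _ hβ.ne', div_mul_cancel₀ _ hβ.ne']

lemma isBalanced_mul_rpow_neg (h : IsMuckenhoupt v t C) (hu : IsAOne u D) (hα : 0 ≤ α)
    (hγ : 0 < γ) : IsBalanced (fun x => v x ^ α * u x ^ (-γ)) α (γ + α * t) where
  measurable := (h.measurable.pow_const _).mul (hu.measurable.pow_const _)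
  ne_zero x := mul_ne_zero
    (ENNReal.rpow_pos (pos_iff_ne_zero.2 (h.ne_zero x)) (h.ne_top x)).ne'
    (ENNReal.rpow_pos (pos_iff_ne_zero.2 (hu.ne_zero x)) (hu.ne_top x)).ne'
  ne_top x := ENNReal.mul_ne_top (ENNReal.rpow_ne_top_of_ne_zero (h.ne_zero x) (h.ne_top x))
    (ENNReal.rpow_ne_top_of_ne_zero (hu.ne_zero x) (hu.ne_top x))
  exists_le := by
    refine ⟨D ^ γ * C ^ α, ENNReal.mul_ne_top
      (ENNReal.rpow_ne_top_of_nonneg hγ.le hu.const_ne_top)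
      (ENNReal.rpow_ne_top_of_nonneg hα h.const_ne_top), fun c r hr => ?_⟩
    refine (mul_le_mul' (powerMean_mul_rpow_neg_le h hu hα hγ c hr)
      (powerMean_inv_mul_rpow_neg_le h hu hα hγ c r)).trans ?_
    set a := ⨍⁻ y in ball c r, u y ∂volume
    calc _ = (D / a * a) ^ γ * ((⨍⁻ y in ball c r, v y ∂volume) *
          (⨍⁻ y in ball c r, v y ^ (-(1 / t)) ∂volume) ^ t) ^ α := by
          rw [ENNReal.mul_rpow_of_nonneg _ _ hγ.le, ENNReal.mul_rpow_of_nonneg _ _ hα,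
            ← ENNReal.rpow_mul, mul_comm t α]
          ring
      _ ≤ D ^ γ * C ^ α := by
          gcongr
          · rw [mul_comm]; exact ENNReal.mul_div_le
          · exact h.le c r hr

end

/-- Extrapolation of weights: the density `E` dominates `Ψ` and moves `W` between classes. -/
lemma IsBalanced.exists_weight {W Ψ : (Fin d → ℝ) → ℝ≥0∞} {α β r e : ℝ} (h : IsBalanced W α β)
    (hα : 0 < α) (hβ : 0 < β) (he : 0 < e) (hre : 0 ≤ r * α - e)
    (hΨ : Measurable Ψ) (hΨt : ∫⁻ x, Ψ x ≠ ⊤) :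
    ∃ E : (Fin d → ℝ) → ℝ≥0∞, Measurable E ∧ (∀ x, E x ≠ 0) ∧ (∀ x, E x ≠ ⊤) ∧
      (∀ᵐ x, Ψ x ≤ E x) ∧ ∫⁻ x, E x ≠ ⊤ ∧
      IsBalanced (fun x => W x ^ r * E x ^ (-e)) (r * α - e) (r * β + e) := by
  obtain ⟨C, hC⟩ := h.isMuckenhoupt hα hβ
  obtain ⟨D, u, hu, hle, hfin⟩ := hC.exists_majorant hΨ hΨt
  have hu0 : ∀ s x, u x ^ (s : ℝ) ≠ 0 := fun s x =>
    (ENNReal.rpow_pos (pos_iff_ne_zero.2 (hu.ne_zero x)) (hu.ne_top x)).ne'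
  have hut : ∀ s x, u x ^ (s : ℝ) ≠ ⊤ := fun s x =>
    ENNReal.rpow_ne_top_of_ne_zero (hu.ne_zero x) (hu.ne_top x)
  refine ⟨fun x => u x ^ (1 + β / α) * W x ^ (1 / α),
    (hu.measurable.pow_const _).mul hC.measurable,
    fun x => mul_ne_zero (hu0 _ x) (hC.ne_zero x),
    fun x => ENNReal.mul_ne_top (hut _ x) (hC.ne_top x), hle, hfin, ?_⟩
  convert! isBalanced_mul_rpow_neg hC hu hre (show 0 < (1 + β / α) * e by positivity) using 1
  · funext x
    rw [ENNReal.mul_rpow_of_ne_zero (hu0 _ x) (hC.ne_zero x), ← ENNReal.rpow_mul,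
      ← ENNReal.rpow_mul, ← ENNReal.rpow_mul, mul_left_comm,
      ← ENNReal.rpow_add _ _ (h.ne_zero x) (h.ne_top x), mul_comm]
    congr 2
    · field_simp
      ring
    · ring
  · field_simp
    ring

end

section

variable {d : ℕ}

lemma cube_eq_closedBall (a : Fin d → ℝ) {r : ℝ} (hr : 0 < r) :
    cube a r = closedBall (fun i => a i + r / 2) (r / 2) := by
  rw [closedBall_pi _ (by positivity), cube]
  congr 1
  funext i
  rw [Real.closedBall_eq_Icc]
  congr 1 <;> ring

lemma cube_ae_eq_ball (a : Fin d → ℝ) {r : ℝ} (hr : 0 < r) :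
    cube a r =ᵐ[volume] ball (fun i => a i + r / 2) (r / 2) := by
  rw [cube_eq_closedBall a hr, ← ball_union_sphere]
  refine union_ae_eq_left_of_ae_eq_empty ?_
  rw [ae_eq_empty]
  exact Measure.addHaar_sphere_of_ne_zero volume _ (by positivity)

lemma restrict_cube (a : Fin d → ℝ) {r : ℝ} (hr : 0 < r) :
    volume.restrict (cube a r) = volume.restrict (ball (fun i => a i + r / 2) (r / 2)) :=
  Measure.restrict_congr_set (cube_ae_eq_ball a hr)

lemma avg_eq (g : (Fin d → ℝ) → ℝ≥0∞) (a : Fin d → ℝ) {r : ℝ} (hr : 0 < r) :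
    avg g a r = ⨍⁻ x in ball (fun i => a i + r / 2) (r / 2), g x ∂volume := by
  rw [avg, ← setLAverage_eq, setLAverage_congr (cube_ae_eq_ball a hr)]

lemma iSup_cube_ne_top_iff {F : (Fin d → ℝ) → ℝ → ℝ≥0∞} :
    (⨆ (a : Fin d → ℝ) (r : ℝ) (_ : 0 < r), F (fun i => a i + r / 2) (r / 2)) ≠ ⊤ ↔
      ∃ C : ℝ≥0∞, C ≠ ⊤ ∧ ∀ (c : Fin d → ℝ) (r : ℝ), 0 < r → F c r ≤ C := by
  constructor
  · intro h
    refine ⟨_, h, fun c r hr => ?_⟩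
    refine le_trans (le_of_eq ?_) (le_iSup₂_of_le (fun i => c i - r) (2 * r)
      (le_iSup_of_le (show 0 < 2 * r by positivity) le_rfl))
    congr 1
    · funext i
      ring
    · ring
  · rintro ⟨C, hC, h⟩
    exact ne_top_of_le_ne_top hC
      (iSup_le fun a => iSup_le fun r => iSup_le fun hr => h _ _ (by positivity))

lemma powerMean_congr {f g : (Fin d → ℝ) → ℝ≥0∞} (h : f =ᵐ[volume] g) (α : ℝ) (c : Fin d → ℝ)
    (r : ℝ) : powerMean f α c r = powerMean g α c r := by
  have h' := ae_restrict_of_ae (s := ball c r) h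
  rw [powerMean, powerMean, essSup_congr_ae h']
  congr 2
  exact laverage_congr (h'.mono fun x hx => by simp [hx])

lemma powerMean_one (f : (Fin d → ℝ) → ℝ≥0∞) (c : Fin d → ℝ) (r : ℝ) :
    powerMean f 1 c r = ⨍⁻ x in ball c r, f x ∂volume := by
  simp [powerMean]

lemma apConst_ne_top_iff {p : ℝ} {w : (Fin d → ℝ) → ℝ} :
    apConst d p w ≠ ⊤ ↔ ∃ C : ℝ≥0∞, C ≠ ⊤ ∧ ∀ (c : Fin d → ℝ) (r : ℝ), 0 < r →
      (⨍⁻ x in ball c r, ofW w x ∂volume) * powerMean (fun x => (ofW w x)⁻¹) (p - 1) c r ≤ C := by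
  rw [← iSup_cube_ne_top_iff, apConst]
  split_ifs with hp
  · refine Iff.of_eq (congrArg (· ≠ ⊤) ?_)
    refine iSup_congr fun a => iSup_congr fun r => iSup_congr fun hr => ?_
    rw [avg_eq _ _ hr, powerMean, if_pos (by rw [hp, sub_self]), restrict_cube a hr]
  · refine Iff.of_eq (congrArg (· ≠ ⊤) ?_)
    refine iSup_congr fun a => iSup_congr fun r => iSup_congr fun hr => ?_
    rw [avg_eq _ _ hr, avg_eq _ _ hr, powerMean, if_neg (sub_ne_zero.2 hp)]
    simp only [ENNReal.rpow_neg, ENNReal.inv_rpow]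

lemma rhConst_ne_top_iff {pp : ℝ≥0∞} {q : ℝ} (hq : 0 < q) (hqp : ENNReal.ofReal q ≤ pp)
    {w : (Fin d → ℝ) → ℝ} :
    rhConst d (ratioConj pp q) w ≠ ⊤ ↔ ∃ C : ℝ≥0∞, C ≠ ⊤ ∧ ∀ (c : Fin d → ℝ) (r : ℝ), 0 < r →
      powerMean (ofW w) (1 - q / pp.toReal) c r / (⨍⁻ x in ball c r, ofW w x ∂volume) ≤ C := by
  by_cases hpp : pp = ⊤
  · subst hpp
    simp only [ratioConj, if_true, rhConst, ENNReal.toReal_top, _root_.div_zero, sub_zero, powerMean_one]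
    exact iff_of_true (by simp) ⟨1, by simp, fun c r _ => ENNReal.div_self_le_one⟩
  have hle : q ≤ pp.toReal := (ENNReal.ofReal_le_iff_le_toReal hpp).1 hqp
  rw [← iSup_cube_ne_top_iff, ratioConj, if_neg hpp, eConj]
  have hP : 0 < pp.toReal := hq.trans_le hle
  rcases hle.eq_or_lt with h | h
  · rw [if_pos (by rw [← h, div_self hq.ne']), rhConst, if_neg (by simp), if_pos rfl]
    refine Iff.of_eq (congrArg (· ≠ ⊤) ?_)
    refine iSup_congr fun a => iSup_congr fun r => iSup_congr fun hr => ?_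
    rw [avg_eq _ _ hr, powerMean, if_pos (by rw [← h, div_self hq.ne', sub_self]),
      restrict_cube a hr]
  · have hα : 0 < 1 - q / pp.toReal := by rw [sub_pos, div_lt_one hP]; exact h
    have h1 : 1 < pp.toReal / q := by rwa [one_lt_div hq]
    have hσ : pp.toReal / q / (pp.toReal / q - 1) = 1 / (1 - q / pp.toReal) := by
      have : pp.toReal - q ≠ 0 := by linarith
      field_simp
    have hα1 : 1 - q / pp.toReal < 1 := by linarith [div_pos hq hP]
    have hσ1 : ENNReal.ofReal (1 / (1 - q / pp.toReal)) ≠ 1 := by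
      rw [Ne, ENNReal.ofReal_eq_one]
      have := one_lt_one_div hα hα1
      linarith
    rw [if_neg (not_le.2 h1), hσ, rhConst, if_neg hσ1, if_neg (by simp),
      ENNReal.toReal_ofReal (by positivity)]
    refine Iff.of_eq (congrArg (· ≠ ⊤) ?_)
    refine iSup_congr fun a => iSup_congr fun r => iSup_congr fun hr => ?_
    rw [avg_eq _ _ hr, avg_eq _ _ hr, powerMean, if_neg hα.ne', one_div_one_div]

lemma IsWeight.lintegral_ball_ne_top {w : (Fin d → ℝ) → ℝ} (hw : IsWeight d w)
    (c : Fin d → ℝ) (r : ℝ) : ∫⁻ x in ball c r, ofW w x ≠ ⊤ := by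
  have := (hw.1.integrableOn_isCompact (isCompact_closedBall c r)).mono_set ball_subset_closedBall
  exact this.lintegral_lt_top.ne

lemma IsWeight.exists_measurable {w : (Fin d → ℝ) → ℝ} (hw : IsWeight d w) :
    ∃ W : (Fin d → ℝ) → ℝ≥0∞, Measurable W ∧ (∀ x, W x ≠ 0) ∧ (∀ x, W x ≠ ⊤) ∧
      W =ᵐ[volume] ofW w := by
  have hm := hw.1.aestronglyMeasurable.aemeasurable
  set w' := hm.mk w with hw'
  refine ⟨fun x => if 0 < w' x then ENNReal.ofReal (w' x) else 1, ?_, fun x => ?_, fun x => ?_, ?_⟩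
  · exact Measurable.ite (measurableSet_lt measurable_const hm.measurable_mk)
      hm.measurable_mk.ennreal_ofReal measurable_const
  · dsimp only
    split_ifs with h
    · simpa using h
    · simp
  · dsimp only
    split_ifs <;> simp
  · filter_upwards [hm.ae_eq_mk, hw.2] with x hx hpos
    rw [← hw'] at hx
    rw [← hx, if_pos hpos, ofW]

/-- A weight in `A_{1+β}` and the reverse Hölder class of exponent `1/α` has a balanced
representative. -/
lemma exists_isBalanced {pp : ℝ≥0∞} {p q : ℝ} (hq : 0 < q) (hqp : ENNReal.ofReal q ≤ pp)
    {w : (Fin d → ℝ) → ℝ} (hA : MemAp d p w) (hR : MemRH d (ratioConj pp q) w) :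
    ∃ W : (Fin d → ℝ) → ℝ≥0∞, W =ᵐ[volume] ofW w ∧
      IsBalanced W (1 - q / pp.toReal) (p - 1) := by
  obtain ⟨W, hm, h0, ht, hae⟩ := hA.1.exists_measurable
  obtain ⟨C₁, hC₁, h₁⟩ := apConst_ne_top_iff.1 hA.2
  obtain ⟨C₂, hC₂, h₂⟩ := (rhConst_ne_top_iff hq hqp).1 hR.2
  refine ⟨W, hae, hm, h0, ht, C₂ * C₁, ENNReal.mul_ne_top hC₂ hC₁, fun c r hr => ?_⟩
  have hav : ⨍⁻ x in ball c r, ofW w x ∂volume = ⨍⁻ x in ball c r, W x ∂volume :=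
    laverage_congr (ae_restrict_of_ae hae.symm)
  have hav0 : ⨍⁻ x in ball c r, W x ∂volume ≠ 0 :=
    setLAverage_ne_zero (volume_ball_ne_zero c hr) (volume_ball_ne_top c r) hm h0
  have havt : ⨍⁻ x in ball c r, ofW w x ∂volume ≠ ⊤ := by
    rw [setLAverage_eq]
    exact ENNReal.div_ne_top (hA.1.lintegral_ball_ne_top c r) (volume_ball_ne_zero c hr)
  have hinv : (fun x => (W x)⁻¹) =ᵐ[volume] fun x => (ofW w x)⁻¹ :=
    hae.mono fun x hx => by simp [hx]
  rw [powerMean_congr hae, powerMean_congr hinv]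
  have h₂' := (ENNReal.div_le_iff (hav ▸ hav0) havt).1 (h₂ c r hr)
  calc _ ≤ C₂ * (⨍⁻ x in ball c r, ofW w x ∂volume) *
        powerMean (fun x => (ofW w x)⁻¹) (p - 1) c r := by gcongr
    _ ≤ C₂ * C₁ := by
        rw [mul_assoc]
        gcongr
        exact h₁ c r hr

lemma laverage_le_powerMean {f : (Fin d → ℝ) → ℝ≥0∞} (hf : Measurable f) {α : ℝ} (h0 : 0 ≤ α)
    (h1 : α ≤ 1) (c : Fin d → ℝ) {r : ℝ} (hr : 0 < r) :
    ⨍⁻ x in ball c r, f x ∂volume ≤ powerMean f α c r := by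
  have hb0 := volume_ball_ne_zero c hr
  have hbt := volume_ball_ne_top c r
  rw [powerMean]
  split_ifs with hα
  · calc ⨍⁻ x in ball c r, f x ∂volume
        ≤ ⨍⁻ x in ball c r, essSup f (volume.restrict (ball c r)) ∂volume :=
          laverage_mono_ae (ENNReal.ae_le_essSup f)
      _ = _ := setLAverage_const hb0 hbt _
  · have := laverage_mul_rpow_le (volume.restrict (ball c r)) (hf.pow_const (1 / α))
      (measurable_const (a := (1 : ℝ≥0∞))) h0 (sub_nonneg.2 h1) (by ring)
    simpa only [ENNReal.one_rpow, mul_one, ← ENNReal.rpow_mul, one_div_mul_cancel hα,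
      ENNReal.rpow_one, setLAverage_one hb0 hbt] using this

lemma one_le_laverage_mul_powerMean {f : (Fin d → ℝ) → ℝ≥0∞} (hf : Measurable f)
    (hf0 : ∀ x, f x ≠ 0) (hft : ∀ x, f x ≠ ⊤) {β : ℝ} (h0 : 0 ≤ β) (c : Fin d → ℝ) {r : ℝ}
    (hr : 0 < r) :
    1 ≤ (⨍⁻ x in ball c r, f x ∂volume) * powerMean (fun x => (f x)⁻¹) β c r := by
  have hb0 := volume_ball_ne_zero c hr
  have hbt := volume_ball_ne_top c r
  rw [powerMean]
  split_ifs with hβ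
  · set S := essSup (fun x => (f x)⁻¹) (volume.restrict (ball c r)) with hS
    calc 1 = ⨍⁻ x in ball c r, 1 ∂volume := (setLAverage_one hb0 hbt).symm
      _ ≤ ⨍⁻ x in ball c r, S * f x ∂volume := by
          refine laverage_mono_ae ?_
          filter_upwards [ENNReal.ae_le_essSup (μ := volume.restrict (ball c r))
            fun x => (f x)⁻¹] with x hx
          rw [← ENNReal.inv_mul_cancel (hf0 x) (hft x)]
          gcongr
      _ = _ := by rw [laverage_const_mul _ hf, mul_comm]
  · have := one_le_laverage_mul hb0 hbt hf hf0 hft (lt_of_le_of_ne h0 (Ne.symm hβ))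
    simpa only [ENNReal.rpow_neg, ENNReal.inv_rpow] using this

/-- A balanced density gives a weight in the corresponding Muckenhoupt and reverse Hölder
classes. -/
lemma IsBalanced.mem {W : (Fin d → ℝ) → ℝ≥0∞} {pp : ℝ≥0∞} {p q : ℝ} (hq : 0 < q)
    (hqp : ENNReal.ofReal q ≤ pp) (hp : 1 ≤ p) (h : IsBalanced W (1 - q / pp.toReal) (p - 1)) :
    MemAp d p (fun x => (W x).toReal) ∧ MemRH d (ratioConj pp q) (fun x => (W x).toReal) := by
  have hW : ofW (fun x => (W x).toReal) = W := funext fun x => ENNReal.ofReal_toReal (h.ne_top x)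
  obtain ⟨C, hC, hle⟩ := h.exists_le
  have hα0 : 0 ≤ 1 - q / pp.toReal := by
    by_cases hpp : pp = ⊤
    · simp [hpp]
    have := (ENNReal.ofReal_le_iff_le_toReal hpp).1 hqp
    rw [sub_nonneg]
    exact div_le_one_of_le₀ this (by positivity)
  have hα1 : 1 - q / pp.toReal ≤ 1 := by
    have : 0 ≤ q / pp.toReal := by positivity
    linarith
  have hβ : 0 ≤ p - 1 := by linarith
  have hone := fun c r => one_le_laverage_mul_powerMean h.measurable h.ne_zero h.ne_top hβ c (r := r)
  have hAp : ∀ (c : Fin d → ℝ) (r : ℝ), 0 < r →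
      (⨍⁻ x in ball c r, W x ∂volume) * powerMean (fun x => (W x)⁻¹) (p - 1) c r ≤ C :=
    fun c r hr => (mul_le_mul_left (laverage_le_powerMean h.measurable hα0 hα1 c hr) _).trans
      (hle c r hr)
  have hint : ∀ (c : Fin d → ℝ) (r : ℝ), 0 < r → ∫⁻ x in ball c r, W x ≠ ⊤ := by
    intro c r hr
    refine setLIntegral_ne_top_of_setLAverage (volume_ball_ne_top c r) fun htop => ?_
    have h1 := hone c r hr
    have h2 := hAp c r hr
    have h3 : powerMean (fun x => (W x)⁻¹) (p - 1) c r ≠ 0 := by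
      intro h0
      simp [h0] at h1
    rw [htop, ENNReal.top_mul h3] at h2
    exact hC (top_le_iff.1 h2)
  have hweight : IsWeight d fun x => (W x).toReal := by
    refine ⟨fun x => ⟨ball x 1, ball_mem_nhds x one_pos, ?_⟩, ?_⟩
    · exact integrable_toReal_of_lintegral_ne_top h.measurable.aemeasurable (hint x 1 one_pos)
    · exact Eventually.of_forall fun x => ENNReal.toReal_pos (h.ne_zero x) (h.ne_top x)
  refine ⟨⟨hweight, apConst_ne_top_iff.2 ⟨C, hC, ?_⟩⟩,
    ⟨hweight, (rhConst_ne_top_iff hq hqp).2 ⟨C, hC, ?_⟩⟩⟩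
  · rw [hW]
    exact hAp
  · rw [hW]
    intro c r hr
    refine ENNReal.div_le_of_le_mul ?_
    calc powerMean W (1 - q / pp.toReal) c r
        ≤ powerMean W (1 - q / pp.toReal) c r * ((⨍⁻ x in ball c r, W x ∂volume) *
            powerMean (fun x => (W x)⁻¹) (p - 1) c r) := le_mul_of_one_le_right' (hone c r hr)
      _ = powerMean W (1 - q / pp.toReal) c r * powerMean (fun x => (W x)⁻¹) (p - 1) c r *
            ⨍⁻ x in ball c r, W x ∂volume := by ring
      _ ≤ _ := by
          gcongr
          exact hle c r hr

end

section

section LowerIntegral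
variable {X : Type*} [MeasurableSpace X] {μ : Measure X}

lemma ae_le_of_lintegral_eq {f g h : X → ℝ≥0∞} (hg : Measurable g) (hgf : g ≤ f)
    (hint : ∫⁻ x, f x ∂μ = ∫⁻ x, g x ∂μ) (hfin : ∫⁻ x, g x ∂μ ≠ ⊤) (hh : Measurable h)
    (hhf : h ≤ f) : ∀ᵐ x ∂μ, h x ≤ g x := by
  have hle : ∫⁻ x, max (g x) (h x) ∂μ ≤ ∫⁻ x, g x ∂μ := by
    rw [← hint]
    exact lintegral_mono fun x => max_le (hgf x) (hhf x)
  have := ae_eq_of_ae_le_of_lintegral_le (Eventually.of_forall fun x => le_max_left (g x) (h x))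
    hfin (hg.max hh).aemeasurable hle
  filter_upwards [this] with x hx
  rw [hx]
  exact le_max_right _ _

lemma exists_measurable_le_lintegral_eq_of_lt [SigmaFinite μ] {f : X → ℝ≥0∞} {R : ℝ≥0∞}
    (hR : R < ∫⁻ x, f x ∂μ) : ∃ g : X → ℝ≥0∞, Measurable g ∧ g ≤ f ∧ ∫⁻ x, g x ∂μ = R := by
  rw [lintegral_eq_nnreal] at hR
  simp only [lt_iSup_iff] at hR
  obtain ⟨φ, hφ, hRφ⟩ := hR
  rw [← SimpleFunc.lintegral_eq_lintegral] at hRφ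
  simp only [SimpleFunc.map_apply] at hRφ
  obtain ⟨g, hg, hgt, hRg⟩ := SimpleFunc.exists_lt_lintegral_simpleFunc_of_lt_lintegral hRφ
  set I := ∫⁻ x, (g x : ℝ≥0∞) ∂μ with hI
  have hI0 : I ≠ 0 := (lt_of_le_of_lt zero_le hRg).ne'
  have hm : Measurable fun x => (g x : ℝ≥0∞) := g.measurable.coe_nnreal_ennreal
  refine ⟨fun x => R / I * g x, hm.const_mul _, fun x => ?_, ?_⟩
  · calc R / I * g x ≤ 1 * g x := by
          gcongr
          exact ENNReal.div_le_of_le_mul (by simpa using hRg.le)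
      _ ≤ φ x := by
          rw [one_mul]
          exact_mod_cast hg x
      _ ≤ f x := hφ x
  · rw [lintegral_const_mul _ hm, ENNReal.div_mul_cancel hI0 hgt.ne]

variable {E : X → ℝ≥0∞}

lemma exists_measurable_rpow_mul_eq (hE : Measurable E) (hE0 : ∀ x, E x ≠ 0) (hEt : ∀ x, E x ≠ ⊤)
    {f : X → ℝ≥0∞} {θ : ℝ} (hθ : 0 < θ) (s : ℝ) (μ : Measure X) :
    ∃ k : X → ℝ≥0∞, Measurable k ∧ k ≤ f ∧
      ∫⁻ x, f x ^ θ * E x ^ s ∂μ = ∫⁻ x, k x ^ θ * E x ^ s ∂μ := by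
  have h0 : ∀ x, E x ^ s ≠ 0 := fun x =>
    (ENNReal.rpow_pos (pos_iff_ne_zero.2 (hE0 x)) (hEt x)).ne'
  have ht : ∀ x, E x ^ s ≠ ⊤ := fun x => ENNReal.rpow_ne_top_of_ne_zero (hE0 x) (hEt x)
  obtain ⟨g, hg, hgf, hint⟩ := exists_measurable_le_lintegral_eq μ fun x => f x ^ θ * E x ^ s
  refine ⟨fun x => (g x / E x ^ s) ^ θ⁻¹, (hg.div (hE.pow_const _)).pow_const _, fun x => ?_, ?_⟩
  · calc (g x / E x ^ s) ^ θ⁻¹ ≤ (f x ^ θ) ^ θ⁻¹ := by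
          gcongr
          exact ENNReal.div_le_of_le_mul (hgf x)
      _ = f x := by rw [← ENNReal.rpow_mul, mul_inv_cancel₀ hθ.ne', ENNReal.rpow_one]
  · rw [hint]
    refine lintegral_congr fun x => ?_
    rw [← ENNReal.rpow_mul, inv_mul_cancel₀ hθ.ne', ENNReal.rpow_one,
      ENNReal.div_mul_cancel (h0 x) (ht x)]

/-- Hölder's inequality without measurability of `f`. -/
lemma lintegral_rpow_mul_rpow_le (hE : Measurable E) (hE0 : ∀ x, E x ≠ 0) (hEt : ∀ x, E x ≠ ⊤)
    (f : X → ℝ≥0∞) {θ : ℝ} (hθ : 0 < θ) (hθ1 : θ ≤ 1) :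
    ∫⁻ x, f x ^ θ * E x ^ (1 - θ) ∂μ ≤ (∫⁻ x, f x ∂μ) ^ θ * (∫⁻ x, E x ∂μ) ^ (1 - θ) := by
  obtain ⟨k, hk, hkf, hint⟩ := exists_measurable_rpow_mul_eq hE hE0 hEt (f := f) hθ (1 - θ) μ
  rw [hint]
  refine (ENNReal.lintegral_mul_norm_pow_le hk.aemeasurable hE.aemeasurable hθ.le
    (sub_nonneg.2 hθ1) (by ring)).trans ?_
  gcongr
  exact hkf _

/-- If every measurable minorant of `f` is dominated by `E`, then `∫ f^r E^{1-r} ≤ ∫ E`. -/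
lemma lintegral_rpow_mul_rpow_le_of_ae_le (hE : Measurable E) (hE0 : ∀ x, E x ≠ 0)
    (hEt : ∀ x, E x ≠ ⊤) {f g : X → ℝ≥0∞} (hg : Measurable g) (hgf : g ≤ f)
    (hint : ∫⁻ x, f x ∂μ = ∫⁻ x, g x ∂μ) (hfin : ∫⁻ x, g x ∂μ ≠ ⊤)
    (hgE : ∀ᵐ x ∂μ, g x ≤ E x) {r : ℝ} (hr : 0 < r) :
    ∫⁻ x, f x ^ r * E x ^ (1 - r) ∂μ ≤ ∫⁻ x, E x ∂μ := by
  obtain ⟨k, hk, hkf, hk'⟩ := exists_measurable_rpow_mul_eq hE hE0 hEt (f := f) hr (1 - r) μ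
  rw [hk']
  refine lintegral_mono_ae ?_
  filter_upwards [ae_le_of_lintegral_eq hg hgf hint hfin hk hkf, hgE] with x hx hx'
  calc k x ^ r * E x ^ (1 - r) ≤ E x ^ r * E x ^ (1 - r) := by
        gcongr
        exact hx.trans hx'
    _ = E x := by
        rw [← ENNReal.rpow_add _ _ (hE0 x) (hEt x), add_sub_cancel, ENNReal.rpow_one]

end LowerIntegral

variable {d : ℕ}

lemma IsBalanced.exists_weight_of_ne_one {W Ψ : (Fin d → ℝ) → ℝ≥0∞} {α β r : ℝ}
    (h : IsBalanced W α β) (hα : 0 < α) (hβ : 0 < β) (hr1 : r ≠ 1)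
    (hα' : 0 ≤ r * α + 1 - r) (hβ' : 0 ≤ r * β + r - 1)
    (hΨ : Measurable Ψ) (hΨt : ∫⁻ x, Ψ x ≠ ⊤) :
    ∃ E : (Fin d → ℝ) → ℝ≥0∞, Measurable E ∧ (∀ x, E x ≠ 0) ∧ (∀ x, E x ≠ ⊤) ∧
      (∀ᵐ x, Ψ x ≤ E x) ∧ ∫⁻ x, E x ≠ ⊤ ∧
      IsBalanced (fun x => W x ^ r * E x ^ (1 - r)) (r * α + 1 - r) (r * β + r - 1) := by
  rcases hr1.lt_or_gt with hr | hr
  · obtain ⟨E, hE, hE0, hEt, hle, hfin, hb⟩ := h.inv.exists_weight (r := r) (e := 1 - r) hβ hα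
      (by linarith) (by linarith) hΨ hΨt
    refine ⟨E, hE, hE0, hEt, hle, hfin, ?_⟩
    convert! hb.inv using 1
    · funext x
      have h1 : (W x)⁻¹ ^ r ≠ 0 :=
        (ENNReal.rpow_pos (by simp [h.ne_top x]) (by simp [h.ne_zero x])).ne'
      have h2 : (W x)⁻¹ ^ r ≠ ⊤ :=
        ENNReal.rpow_ne_top_of_ne_zero (by simp [h.ne_top x]) (by simp [h.ne_zero x])
      rw [ENNReal.mul_inv (.inl h1) (.inl h2), ENNReal.inv_rpow, inv_inv, ENNReal.rpow_neg, inv_inv]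
    · ring
    · ring
  · obtain ⟨E, hE, hE0, hEt, hle, hfin, hb⟩ := h.exists_weight (r := r) (e := r - 1) hα hβ
      (by linarith) (by linarith) hΨ hΨt
    refine ⟨E, hE, hE0, hEt, hle, hfin, ?_⟩
    convert! hb using 1
    · simp only [neg_sub]
    · ring
    · ring

lemma opBounded_wLpNorm_iff {p : ℝ} (hp : 0 < p) {w : (Fin d → ℝ) → ℝ}
    {T : ((Fin d → ℝ) → ℂ) → ((Fin d → ℝ) → ℂ)} :
    OpBounded (wLpNorm d p w) (wLpNorm d p w) T ↔ ∃ C : ℝ≥0∞, C ≠ ⊤ ∧ ∀ f,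
      ∫⁻ x, ‖T f x‖ₑ ^ p * ofW w x ≤ C * ∫⁻ x, ‖f x‖ₑ ^ p * ofW w x := by
  have hp' : 0 < 1 / p := by positivity
  constructor
  · rintro ⟨C, hC, h⟩
    refine ⟨C ^ p, ENNReal.rpow_ne_top_of_nonneg hp.le hC, fun f => ?_⟩
    have := ENNReal.rpow_le_rpow (h f) hp.le
    rwa [ENNReal.mul_rpow_of_nonneg _ _ hp.le, wLpNorm, wLpNorm, ← ENNReal.rpow_mul,
      ← ENNReal.rpow_mul, one_div_mul_cancel hp.ne', ENNReal.rpow_one, ENNReal.rpow_one] at this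
  · rintro ⟨C, hC, h⟩
    refine ⟨C ^ (1 / p), ENNReal.rpow_ne_top_of_nonneg hp'.le hC, fun f => ?_⟩
    have := ENNReal.rpow_le_rpow (h f) hp'.le
    rwa [ENNReal.mul_rpow_of_nonneg _ _ hp'.le] at this

/-- An unbounded linear operator maps some arbitrarily small function to a large one. -/
lemma exists_small_of_not_bounded {T : ((Fin d → ℝ) → ℂ) →ₗ[ℂ] ((Fin d → ℝ) → ℂ)} {p : ℝ}
    (hp : 0 < p) {W : (Fin d → ℝ) → ℝ≥0∞}
    (h : ¬ ∃ C : ℝ≥0∞, C ≠ ⊤ ∧ ∀ f, ∫⁻ x, ‖T f x‖ₑ ^ p * W x ≤ C * ∫⁻ x, ‖f x‖ₑ ^ p * W x)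
    {ε R : ℝ≥0∞} (hε : ε ≠ 0) (hεt : ε ≠ ⊤) (hR : R ≠ 0) (hRt : R ≠ ⊤) :
    ∃ f, ∫⁻ x, ‖f x‖ₑ ^ p * W x ≤ ε ∧ R < ∫⁻ x, ‖T f x‖ₑ ^ p * W x := by
  push Not at h
  obtain ⟨f, hf⟩ := h (R / ε) (ENNReal.div_ne_top hRt hε)
  have hscale : ∀ (a : ℝ≥0) (g : (Fin d → ℝ) → ℂ),
      ∫⁻ x, ‖(((a ^ p⁻¹ : ℝ≥0) : ℝ) : ℂ) • g x‖ₑ ^ p * W x = a * ∫⁻ x, ‖g x‖ₑ ^ p * W x := by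
    intro a g
    rw [← lintegral_const_mul' _ _ ENNReal.coe_ne_top]
    refine lintegral_congr fun x => ?_
    have : ‖(((a ^ p⁻¹ : ℝ≥0) : ℝ) : ℂ)‖ₑ ^ p = a := by
      rw [← ofReal_norm, Complex.norm_real, ofReal_norm, NNReal.enorm_eq,
        ENNReal.coe_rpow_of_nonneg _ (by positivity), ← ENNReal.rpow_mul,
        inv_mul_cancel₀ hp.ne', ENNReal.rpow_one]
    rw [enorm_smul, ENNReal.mul_rpow_of_nonneg _ _ hp.le, this, mul_assoc]
  set N := ∫⁻ x, ‖f x‖ₑ ^ p * W x with hN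
  set M := ∫⁻ x, ‖T f x‖ₑ ^ p * W x with hM
  suffices ∃ a : ℝ≥0, a * N ≤ ε ∧ R < a * M by
    obtain ⟨a, h1, h2⟩ := this
    refine ⟨(((a ^ p⁻¹ : ℝ≥0) : ℝ) : ℂ) • f, ?_, ?_⟩
    · simp only [Pi.smul_apply, hscale]
      exact h1
    · simp only [map_smul, Pi.smul_apply, hscale]
      exact h2
  have hC0 : R / ε ≠ 0 := ENNReal.div_ne_zero.2 ⟨hR, hεt⟩
  by_cases hN0 : N = 0
  · rw [hN0, mul_zero] at hf
    obtain ⟨n, hn⟩ := ENNReal.exists_nat_mul_gt hf.ne' hRt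
    exact ⟨n, by simp [hN0], by simpa using hn⟩
  have hNt : N ≠ ⊤ := by
    rintro hNt
    rw [hNt, ENNReal.mul_top hC0] at hf
    exact not_top_lt hf
  have hεN : ε / N ≠ ⊤ := ENNReal.div_ne_top hεt hN0
  have hεN0 : ε / N ≠ 0 := ENNReal.div_ne_zero.2 ⟨hε, hNt⟩
  refine ⟨(ε / N).toNNReal, ?_, ?_⟩
  · rw [ENNReal.coe_toNNReal hεN, ENNReal.div_mul_cancel hN0 hNt]
  · rw [ENNReal.coe_toNNReal hεN]
    calc R = ε / N * (R / ε * N) := by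
          rw [mul_comm (R / ε), ← mul_assoc, ENNReal.div_mul_cancel hN0 hNt,
            ENNReal.mul_div_cancel hε hεt]
      _ < ε / N * M := (ENNReal.mul_lt_mul_iff_right hεN0 hεN).2 hf

lemma exists_two_pow_gt {K : ℝ≥0∞} (hK : K ≠ ⊤) : ∃ n : ℕ, K < 2 ^ n := by
  obtain ⟨n, hn⟩ := ENNReal.exists_nat_gt hK
  exact ⟨n, hn.trans (by exact_mod_cast n.lt_two_pow_self)⟩

end

section

lemma tsum_inv_two_pow_ne_top : ∑' n : ℕ, (2⁻¹ : ℝ≥0∞) ^ n ≠ ⊤ := by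
  rw [ENNReal.tsum_geometric, ENNReal.one_sub_inv_two, inv_inv]
  exact ENNReal.ofNat_ne_top

variable {d : ℕ} {T : ((Fin d → ℝ) → ℂ) →ₗ[ℂ] ((Fin d → ℝ) → ℂ)} {p r : ℝ}
  {W : (Fin d → ℝ) → ℝ≥0∞}

lemma exists_bound_of_one_lt (hp : 0 < p) (hr : 1 < r)
    (h : ∀ Ψ : (Fin d → ℝ) → ℝ≥0∞, Measurable Ψ → ∫⁻ x, Ψ x ≠ ⊤ →
      ∃ E : (Fin d → ℝ) → ℝ≥0∞, Measurable E ∧ (∀ x, E x ≠ 0) ∧ (∀ x, E x ≠ ⊤) ∧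
        (∀ᵐ x, Ψ x ≤ E x) ∧ ∫⁻ x, E x ≠ ⊤ ∧ ∃ C : ℝ≥0∞, C ≠ ⊤ ∧ ∀ f,
          ∫⁻ x, (‖T f x‖ₑ ^ p * W x) ^ r * E x ^ (1 - r) ≤
            C * ∫⁻ x, (‖f x‖ₑ ^ p * W x) ^ r * E x ^ (1 - r)) :
    ∃ C : ℝ≥0∞, C ≠ ⊤ ∧ ∀ f,
      ∫⁻ x, ‖T f x‖ₑ ^ p * W x ≤ C * ∫⁻ x, ‖f x‖ₑ ^ p * W x := by
  have hr0 : 0 < r := by linarith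
  by_contra hT
  have hseq : ∀ n : ℕ, ∃ f, ∫⁻ x, ‖f x‖ₑ ^ p * W x ≤ 2⁻¹ ^ n ∧
      2 ^ n < ∫⁻ x, ‖T f x‖ₑ ^ p * W x := fun n =>
    exists_small_of_not_bounded hp hT (by simp) (by simp) (by simp) (by simp)
  choose f hf hTf using hseq
  choose g hg hgf hint using fun n =>
    exists_measurable_le_lintegral_eq volume fun x => ‖f n x‖ₑ ^ p * W x
  have hgn : ∀ n, ∫⁻ x, g n x ≤ 2⁻¹ ^ n := fun n => (hint n).symm.le.trans (hf n)
  obtain ⟨E, hE, hE0, hEt, hΨE, hEfin, C, hC, hbd⟩ := h (fun x => ∑' n, g n x)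
    (Measurable.tsum hg) (by
      rw [lintegral_tsum fun n => (hg n).aemeasurable]
      exact ne_top_of_le_ne_top tsum_inv_two_pow_ne_top (ENNReal.tsum_le_tsum hgn))
  have hinv : 0 ≤ 1 - r⁻¹ := sub_nonneg.2 (inv_le_one_of_one_le₀ hr.le)
  obtain ⟨n, hn⟩ := exists_two_pow_gt (K := (C * ∫⁻ x, E x) ^ r⁻¹ * (∫⁻ x, E x) ^ (1 - r⁻¹))
    (ENNReal.mul_ne_top (ENNReal.rpow_ne_top_of_nonneg (by positivity)
      (ENNReal.mul_ne_top hC hEfin)) (ENNReal.rpow_ne_top_of_nonneg hinv hEfin))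
  refine (hn.trans (hTf n)).not_ge ?_
  calc ∫⁻ x, ‖T (f n) x‖ₑ ^ p * W x
      = ∫⁻ x, ((‖T (f n) x‖ₑ ^ p * W x) ^ r * E x ^ (1 - r)) ^ r⁻¹ * E x ^ (1 - r⁻¹) := by
        refine lintegral_congr fun x => ?_
        rw [ENNReal.mul_rpow_of_nonneg _ _ (by positivity), ← ENNReal.rpow_mul,
          mul_inv_cancel₀ hr0.ne', ENNReal.rpow_one, mul_assoc, ← ENNReal.rpow_mul,
          ← ENNReal.rpow_add _ _ (hE0 x) (hEt x)]
        have : (1 - r) * r⁻¹ + (1 - r⁻¹) = 0 := by field_simp; ring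
        rw [this, ENNReal.rpow_zero, mul_one]
    _ ≤ (∫⁻ x, (‖T (f n) x‖ₑ ^ p * W x) ^ r * E x ^ (1 - r)) ^ r⁻¹ *
          (∫⁻ x, E x) ^ (1 - r⁻¹) :=
        lintegral_rpow_mul_rpow_le hE hE0 hEt _ (by positivity) (by linarith)
    _ ≤ (C * ∫⁻ x, E x) ^ r⁻¹ * (∫⁻ x, E x) ^ (1 - r⁻¹) := by
        gcongr
        refine (hbd (f n)).trans (mul_le_mul' le_rfl ?_)
        refine lintegral_rpow_mul_rpow_le_of_ae_le hE hE0 hEt (hg n) (hgf n) (hint n)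
          (ne_top_of_le_ne_top (by simp) (hgn n)) ?_ hr0
        filter_upwards [hΨE] with x hx using (ENNReal.le_tsum n).trans hx

lemma exists_bound_of_lt_one (hp : 0 < p) (hr0 : 0 < r) (hr : r < 1)
    (h : ∀ Ψ : (Fin d → ℝ) → ℝ≥0∞, Measurable Ψ → ∫⁻ x, Ψ x ≠ ⊤ →
      ∃ E : (Fin d → ℝ) → ℝ≥0∞, Measurable E ∧ (∀ x, E x ≠ 0) ∧ (∀ x, E x ≠ ⊤) ∧
        (∀ᵐ x, Ψ x ≤ E x) ∧ ∫⁻ x, E x ≠ ⊤ ∧ ∃ C : ℝ≥0∞, C ≠ ⊤ ∧ ∀ f,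
          ∫⁻ x, (‖T f x‖ₑ ^ p * W x) ^ r * E x ^ (1 - r) ≤
            C * ∫⁻ x, (‖f x‖ₑ ^ p * W x) ^ r * E x ^ (1 - r)) :
    ∃ C : ℝ≥0∞, C ≠ ⊤ ∧ ∀ f,
      ∫⁻ x, ‖T f x‖ₑ ^ p * W x ≤ C * ∫⁻ x, ‖f x‖ₑ ^ p * W x := by
  by_contra hT
  have hseq : ∀ n : ℕ, ∃ f, ∫⁻ x, ‖f x‖ₑ ^ p * W x ≤ ((2⁻¹ ^ n * 2⁻¹ ^ n : ℝ≥0∞)) ^ r⁻¹ ∧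
      2⁻¹ ^ n < ∫⁻ x, ‖T f x‖ₑ ^ p * W x := fun n =>
    exists_small_of_not_bounded hp hT
      (ENNReal.rpow_pos (by simp [pos_iff_ne_zero])
        (ENNReal.mul_ne_top (by simp) (by simp))).ne'
      (ENNReal.rpow_ne_top_of_nonneg (by positivity) (ENNReal.mul_ne_top (by simp) (by simp)))
      (by simp) (by simp)
  choose f hf hTf using hseq
  choose g hg hgf hint using fun n => exists_measurable_le_lintegral_eq_of_lt (hTf n)
  obtain ⟨E, hE, hE0, hEt, hΨE, hEfin, C, hC, hbd⟩ := h (fun x => ∑' n, g n x)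
    (Measurable.tsum hg) (by
      rw [lintegral_tsum fun n => (hg n).aemeasurable]
      simpa only [hint] using tsum_inv_two_pow_ne_top)
  have hK : (∫⁻ x, E x) ^ (1 - r) ≠ ⊤ := ENNReal.rpow_ne_top_of_nonneg (by linarith) hEfin
  obtain ⟨n, hn⟩ := exists_two_pow_gt (K := C * (∫⁻ x, E x) ^ (1 - r)) (ENNReal.mul_ne_top hC hK)
  refine hn.not_ge ?_
  have key : (2⁻¹ : ℝ≥0∞) ^ n ≤ C * (2⁻¹ ^ n * 2⁻¹ ^ n * (∫⁻ x, E x) ^ (1 - r)) := by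
    calc (2⁻¹ : ℝ≥0∞) ^ n = ∫⁻ x, g n x := (hint n).symm
      _ ≤ ∫⁻ x, (‖T (f n) x‖ₑ ^ p * W x) ^ r * E x ^ (1 - r) := by
          refine lintegral_mono_ae ?_
          filter_upwards [hΨE] with x hx
          calc g n x = g n x ^ r * g n x ^ (1 - r) := by
                rw [← ENNReal.rpow_add_of_nonneg _ _ hr0.le (by linarith), add_sub_cancel,
                  ENNReal.rpow_one]
            _ ≤ _ := mul_le_mul' (ENNReal.rpow_le_rpow (hgf n x) hr0.le)
                (ENNReal.rpow_le_rpow ((ENNReal.le_tsum n).trans hx) (by linarith))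
      _ ≤ C * ∫⁻ x, (‖f n x‖ₑ ^ p * W x) ^ r * E x ^ (1 - r) := hbd (f n)
      _ ≤ C * ((∫⁻ x, ‖f n x‖ₑ ^ p * W x) ^ r * (∫⁻ x, E x) ^ (1 - r)) := by
          gcongr
          exact lintegral_rpow_mul_rpow_le hE hE0 hEt _ hr0 hr.le
      _ ≤ C * (2⁻¹ ^ n * 2⁻¹ ^ n * (∫⁻ x, E x) ^ (1 - r)) := by
          gcongr
          refine (ENNReal.rpow_le_rpow (hf n) hr0.le).trans_eq ?_
          rw [← ENNReal.rpow_mul, inv_mul_cancel₀ hr0.ne', ENNReal.rpow_one]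
  have h2 : (2 : ℝ≥0∞) ^ n * 2⁻¹ ^ n = 1 := by
    rw [← mul_pow, ENNReal.mul_inv_cancel (by simp) (by simp), one_pow]
  calc (2 : ℝ≥0∞) ^ n = 2 ^ n * 2 ^ n * 2⁻¹ ^ n := by rw [mul_assoc, h2, mul_one]
    _ ≤ 2 ^ n * 2 ^ n * (C * (2⁻¹ ^ n * 2⁻¹ ^ n * (∫⁻ x, E x) ^ (1 - r))) := by gcongr
    _ = (2 ^ n * 2⁻¹ ^ n) * (2 ^ n * 2⁻¹ ^ n) * (C * (∫⁻ x, E x) ^ (1 - r)) := by ring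
    _ = C * (∫⁻ x, E x) ^ (1 - r) := by rw [h2, one_mul, one_mul]

end

end

end PaperMorrey

open PaperMorrey MeasureTheory ENNReal

/-- **Limited-range Rubio de Francia extrapolation** (Auscher–Martell, Rubio de Francia).
Let `1 ≤ p₋ < p₊ ≤ ∞` and let `T` be a linear operator defined and bounded on
`L^{p₁}(w̃)` for some `p₁ ∈ [p₋,p₊]` and all `w̃ ∈ A_{p₁/p₋} ∩ RH_{(p₊/p₁)'}`.
Then `T` is bounded on `L^p(w)` for all `p ∈ (p₋,p₊)` and all
`w ∈ A_{p/p₋} ∩ RH_{(p₊/p)'}`. -/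
theorem limited_range_extrapolation
    (d : ℕ) (pMinus : ℝ) (pPlus : ℝ≥0∞)
    (hpMinus : 1 ≤ pMinus) (hlt : ENNReal.ofReal pMinus < pPlus)
    (T : ((Fin d → ℝ) → ℂ) →ₗ[ℂ] ((Fin d → ℝ) → ℂ))
    (p1 : ℝ) (hp1l : pMinus ≤ p1) (hp1r : ENNReal.ofReal p1 ≤ pPlus)
    (hbdd : ∀ w : (Fin d → ℝ) → ℝ,
      MemAp d (p1 / pMinus) w → MemRH d (ratioConj pPlus p1) w →
      OpBounded (wLpNorm d p1 w) (wLpNorm d p1 w) ⇑T) :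
    ∀ (p : ℝ) (w : (Fin d → ℝ) → ℝ),
      pMinus < p → ENNReal.ofReal p < pPlus →
      MemAp d (p / pMinus) w → MemRH d (ratioConj pPlus p) w →
      OpBounded (wLpNorm d p w) (wLpNorm d p w) ⇑T := by
  intro p w hpl hpr hA hR
  have hm0 : 0 < pMinus := by linarith
  have hp : 0 < p := by linarith
  have hp1 : 0 < p1 := by linarith
  by_cases hpp : p1 = p
  · exact hpp ▸ hbdd w (hpp ▸ hA) (hpp ▸ hR)
  obtain ⟨W, hWw, hW⟩ := exists_isBalanced hp hpr.le hA hR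
  have hα : 0 < 1 - p / pPlus.toReal := by
    by_cases htop : pPlus = ⊤
    · simp [htop]
    · have := (ENNReal.ofReal_lt_iff_lt_toReal hp.le htop).1 hpr
      exact sub_pos.2 ((div_lt_one (hp.trans this)).2 this)
  have hα1 : 0 ≤ 1 - p1 / pPlus.toReal := by
    by_cases htop : pPlus = ⊤
    · simp [htop]
    · have := (ENNReal.ofReal_le_iff_le_toReal htop).1 hp1r
      exact sub_nonneg.2 ((div_le_one (hp1.trans_le this)).2 this)
  have hβ : 0 < p / pMinus - 1 := sub_pos.2 ((one_lt_div hm0).2 hpl)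
  have hβ1 : 1 ≤ p1 / pMinus := (one_le_div hm0).2 hp1l
  set r := p1 / p with hr
  have hr0 : 0 < r := by positivity
  have hr1 : r ≠ 1 := fun h => hpp ((div_eq_one_iff_eq hp.ne').1 h)
  have hpr1 : p * r = p1 := mul_div_cancel₀ p1 hp.ne'
  have hαr : r * (1 - p / pPlus.toReal) + 1 - r = 1 - p1 / pPlus.toReal := by
    rw [← hpr1]; ring
  have hβr : r * (p / pMinus - 1) + r - 1 = p1 / pMinus - 1 := by
    rw [← hpr1]; ring
  have hmain : ∀ Ψ : (Fin d → ℝ) → ℝ≥0∞, Measurable Ψ → ∫⁻ x, Ψ x ≠ ⊤ →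
      ∃ E : (Fin d → ℝ) → ℝ≥0∞, Measurable E ∧ (∀ x, E x ≠ 0) ∧ (∀ x, E x ≠ ⊤) ∧
        (∀ᵐ x, Ψ x ≤ E x) ∧ ∫⁻ x, E x ≠ ⊤ ∧ ∃ C : ℝ≥0∞, C ≠ ⊤ ∧ ∀ f,
          ∫⁻ x, (‖T f x‖ₑ ^ p * W x) ^ r * E x ^ (1 - r) ≤
            C * ∫⁻ x, (‖f x‖ₑ ^ p * W x) ^ r * E x ^ (1 - r) := by
    intro Ψ hΨ hΨt
    obtain ⟨E, hE, hE0, hEt, hΨE, hEfin, hbal⟩ := hW.exists_weight_of_ne_one hα hβ hr1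
      (by rwa [hαr]) (by rw [hβr]; linarith) hΨ hΨt
    refine ⟨E, hE, hE0, hEt, hΨE, hEfin, ?_⟩
    rw [hαr, hβr] at hbal
    obtain ⟨hA1, hR1⟩ := hbal.mem hp1 hp1r hβ1
    obtain ⟨C, hC, hbd⟩ := (opBounded_wLpNorm_iff hp1).1 (hbdd _ hA1 hR1)
    refine ⟨C, hC, fun f => ?_⟩
    have heq : ∀ (g : (Fin d → ℝ) → ℂ) (x : Fin d → ℝ),
        ‖g x‖ₑ ^ p1 * ofW (fun x => (W x ^ r * E x ^ (1 - r)).toReal) x =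
          (‖g x‖ₑ ^ p * W x) ^ r * E x ^ (1 - r) := by
      intro g x
      rw [ofW, ENNReal.ofReal_toReal (hbal.ne_top x), ENNReal.mul_rpow_of_nonneg _ _ hr0.le,
        ← ENNReal.rpow_mul, hpr1, mul_assoc]
    simpa only [heq] using hbd f
  have hcongr : ∀ g : (Fin d → ℝ) → ℂ,
      ∫⁻ x, ‖g x‖ₑ ^ p * ofW w x = ∫⁻ x, ‖g x‖ₑ ^ p * W x := fun g =>
    lintegral_congr_ae (by filter_upwards [hWw] with x hx; rw [hx])
  rw [opBounded_wLpNorm_iff hp]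
  simp only [hcongr]
  rcases hr1.lt_or_gt with h1 | h1
  · exact exists_bound_of_lt_one hp hr0 h1 hmain
  · exact exists_bound_of_one_lt hp h1 hmain
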